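/- arXiv:2409.00901 — 3 statements merged into one kernel-verified Lean document; each statement's English description precedes it below -/
import Mathlib

section
/- (Representation of dense integer vectors) Let N, M ∈ ℕ with 1 ≤ N ≤ M and let x = (x₁,…,x_N) ∈ ℤ^N satisfy Σ_{n=1}^N |x_n| ≤ M. Then for any S, T ∈ ℕ with S, T ≥ 1, there exists g ∈ NN_{1,1}(W, L) with W = 22·max{⌈M/(S·√(N(T+2)))⌉, ⌈(M/N)^{1/T}⌉} + 12 and L = 4·⌈SN/M⌉·(T+2), such that g(n) = x_n for all n = 1,…,N. -/
open MeasureTheory ENNReal Finset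

noncomputable section

/-- The ReLU activation function. -/
def relu (t : ℝ) : ℝ := max t 0

/-- `A` is an affine map `ℝ^n → ℝ^m`. -/
def IsAffineMap {n m : ℕ} (A : (Fin n → ℝ) → (Fin m → ℝ)) : Prop :=
  ∃ (M : Matrix (Fin m) (Fin n) ℝ) (c : Fin m → ℝ),
    ∀ x i, A x i = (∑ j, M i j * x j) + c i

/-- Auxiliary definition of the ReLU network class, by recursion on the number
of hidden layers. -/
def NNaux (k W : ℕ) : ℕ → (d : ℕ) → Set ((Fin d → ℝ) → (Fin k → ℝ))
  | 0, _ => {g | IsAffineMap g}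
  | (L + 1), d => {g | ∃ N : ℕ, 1 ≤ N ∧ N ≤ W ∧
      ∃ (A : (Fin d → ℝ) → (Fin N → ℝ)) (h : (Fin N → ℝ) → (Fin k → ℝ)),
        IsAffineMap A ∧ h ∈ NNaux k W L N ∧
        g = fun x => h (fun i => relu (A x i))}

/-- The class `NN_{d,k}(W,L)` of functions `ℝ^d → ℝ^k` computed by fully connected
ReLU networks with width at most `W` and `L` hidden layers. -/
def NN (d k W L : ℕ) : Set ((Fin d → ℝ) → (Fin k → ℝ)) := NNaux k W L d

end

theorem NN_append {d n k W L : ℕ} (hn : 1 ≤ n) (hnW : n ≤ W)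
    {f : (Fin d → ℝ) → (Fin n → ℝ)} (hf : f ∈ NN d n W L)
    {B : (Fin n → ℝ) → (Fin k → ℝ)} (hB : IsAffineMap B) :
    (fun x => B (fun i => relu (f x i))) ∈ NN d k W (L + 1) := by
  induction L generalizing d with
  | zero => exact ⟨n, hn, hnW, f, B, hf, hB, rfl⟩
  | succ L ih =>
    obtain ⟨N, h1, h2, A, h, hA, hh, rfl⟩ := hf
    exact ⟨N, h1, h2, A, _, hA, ih hh, rfl⟩

section Reach

variable {X : Type*}

/-- The functions that are affine combinations of functions in `Φ`. -/
def affSpan (Φ : Set (X → ℝ)) : Submodule ℝ (X → ℝ) :=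
  Submodule.span ℝ (insert 1 Φ)

theorem subset_affSpan {Φ : Set (X → ℝ)} {φ : X → ℝ} (h : φ ∈ Φ) : φ ∈ affSpan Φ :=
  Submodule.subset_span (Set.mem_insert_of_mem _ h)

theorem const_mem_affSpan (Φ : Set (X → ℝ)) (c : ℝ) : (fun _ => c) ∈ affSpan Φ := by
  have h : (1 : X → ℝ) ∈ affSpan Φ := Submodule.subset_span (Set.mem_insert _ _)
  have := (affSpan Φ).smul_mem c h
  convert this using 1
  ext x
  simp

theorem affSpan_le {Φ Ψ : Set (X → ℝ)} (h : Φ ⊆ affSpan Ψ) : affSpan Φ ≤ affSpan Ψ := by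
  refine Submodule.span_le.2 (Set.insert_subset ?_ h)
  exact Submodule.subset_span (Set.mem_insert _ _)

theorem affSpan_mono {Φ Ψ : Set (X → ℝ)} (h : Φ ⊆ Ψ) : affSpan Φ ≤ affSpan Ψ :=
  affSpan_le fun _ hφ => subset_affSpan (h hφ)

theorem mem_affSpan_range {n : ℕ} {u : Fin n → X → ℝ} {φ : X → ℝ}
    (h : φ ∈ affSpan (Set.range u)) :
    ∃ (a : Fin n → ℝ) (c : ℝ), ∀ x, φ x = (∑ j, a j * u j x) + c := by
  obtain ⟨c, z, hz, rfl⟩ := Submodule.mem_span_insert.1 h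
  obtain ⟨a, rfl⟩ := (Submodule.mem_span_range_iff_exists_fun ℝ).1 hz
  refine ⟨a, c, fun x => ?_⟩
  simp [Finset.sum_apply, add_comm]

/-- All affine combinations of functions in `Φ` can be computed, on the points `inp x`, by networks
of width `W` with `L` hidden layers. -/
def Reach (inp : X → ℝ) (W L : ℕ) (Φ : Set (X → ℝ)) : Prop :=
  ∀ (p : ℕ) (φ : Fin p → X → ℝ), (∀ q, φ q ∈ affSpan Φ) →
    ∃ f ∈ NN 1 p W L, ∀ x q, f (fun _ => inp x) q = φ q x

/-- All functions in `Ψ` are affine combinations of at most `w` common neurons reading affine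
combinations of functions in `Φ`. -/
def Shallow (w : ℕ) (Φ Ψ : Set (X → ℝ)) : Prop :=
  ∃ s : Finset (X → ℝ), s.card ≤ w ∧ (∀ a ∈ s, a ∈ affSpan Φ) ∧
    Ψ ⊆ affSpan ((fun (a : X → ℝ) x => relu (a x)) '' (s : Set (X → ℝ)))

variable {inp : X → ℝ} {W L w w' : ℕ} {Φ Ψ Ψ' : Set (X → ℝ)} {φ ψ : X → ℝ}

theorem reach_input (inp : X → ℝ) (W : ℕ) : Reach inp W 0 {inp} := by
  intro p φ h
  have h' : ∀ q, ∃ (a : Fin 1 → ℝ) (c : ℝ), ∀ x, φ q x = (∑ j, a j * inp x) + c := fun q =>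
    mem_affSpan_range (u := fun _ : Fin 1 => inp) (by simpa [Set.range_const] using h q)
  choose a c hac using h'
  exact ⟨fun x i => (∑ j, Matrix.of a i j * x j) + c i, ⟨Matrix.of a, c, fun _ _ => rfl⟩,
    fun x q => (hac q x).symm⟩

theorem Reach.of_subset (h : Reach inp W L Φ) (hΨ : Ψ ⊆ affSpan Φ) : Reach inp W L Ψ :=
  fun p φ hφ => h p φ fun q => affSpan_le hΨ (hφ q)

theorem Reach.step (h : Reach inp W L Φ) (hΨ : Shallow w Φ Ψ) (hw : w + 1 ≤ W) :
    Reach inp W (L + 1) Ψ := by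
  classical
  obtain ⟨s, hs, hsΦ, hΨs⟩ := hΨ
  intro p φ hφ
  set s₀ : Finset (X → ℝ) := insert 0 s with hs₀
  have hcard : s₀.card ≤ W := (Finset.card_insert_le _ _).trans (by omega)
  have hpos : 1 ≤ s₀.card := Finset.card_pos.2 ⟨0, Finset.mem_insert_self _ _⟩
  let e := s₀.equivFin
  obtain ⟨f, hf, hfe⟩ := h s₀.card (fun j => (e.symm j : X → ℝ)) (by
    intro q
    rcases Finset.mem_insert.1 (e.symm q).2 with h0 | h0
    · rw [h0]; exact Submodule.zero_mem _
    · exact hsΦ _ h0)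
  have key : ∀ q, ∃ (a : Fin s₀.card → ℝ) (c : ℝ), ∀ x,
      φ q x = (∑ j, a j * relu ((e.symm j : X → ℝ) x)) + c := by
    intro q
    refine mem_affSpan_range (u := fun j x => relu ((e.symm j : X → ℝ) x)) ?_
    refine affSpan_le (hΨs.trans (affSpan_mono ?_)) (hφ q)
    rintro _ ⟨a, ha, rfl⟩
    exact ⟨e ⟨a, Finset.mem_insert_of_mem ha⟩, by simp⟩
  choose a c hac using key
  refine ⟨_, NN_append hpos hcard hf
    (B := fun y i => (∑ j, Matrix.of a i j * y j) + c i) ⟨Matrix.of a, c, fun _ _ => rfl⟩, ?_⟩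
  intro x q
  rw [hac q x]
  simp [hfe]

theorem Shallow.weaken (h : Shallow w Φ Ψ) (hw : w ≤ w') : Shallow w' Φ Ψ :=
  let ⟨s, hs, h⟩ := h
  ⟨s, hs.trans hw, h⟩

theorem Shallow.of_subset (h : Shallow w Φ Ψ) (hΨ : Ψ' ⊆ affSpan Ψ) : Shallow w Φ Ψ' :=
  let ⟨s, hs, h, h'⟩ := h
  ⟨s, hs, h, fun _ hψ => affSpan_le h' (hΨ hψ)⟩

theorem Shallow.union (h : Shallow w Φ Ψ) (h' : Shallow w' Φ Ψ') :
    Shallow (w + w') Φ (Ψ ∪ Ψ') := by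
  classical
  obtain ⟨s, hs, hs1, hs2⟩ := h
  obtain ⟨t, ht, ht1, ht2⟩ := h'
  refine ⟨s ∪ t, (Finset.card_union_le _ _).trans (by omega), ?_, Set.union_subset ?_ ?_⟩
  · intro a ha
    rcases Finset.mem_union.1 ha with ha | ha
    exacts [hs1 a ha, ht1 a ha]
  · refine hs2.trans (affSpan_mono (Set.image_mono ?_))
    simp
  · refine ht2.trans (affSpan_mono (Set.image_mono ?_))
    simp

theorem Shallow.insert (h : Shallow w Φ {φ}) (h' : Shallow w' Φ Ψ) :
    Shallow (w + w') Φ (insert φ Ψ) := by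
  rw [Set.insert_eq]
  exact h.union h'

theorem shallow_empty (Φ : Set (X → ℝ)) : Shallow 0 Φ (∅ : Set (X → ℝ)) :=
  ⟨∅, by simp⟩

theorem shallow_range {n : ℕ} {F : Fin n → X → ℝ} (h : ∀ i, Shallow w Φ {F i}) :
    Shallow (n * w) Φ (Set.range F) := by
  induction n with
  | zero => simpa using shallow_empty Φ
  | succ n ih =>
    have := (h 0).insert (ih (F := fun i => F i.succ) fun i => h i.succ)
    rw [Fin.range_fin_succ]
    exact this.weaken (by linarith [add_mul n 1 w])

theorem Shallow.add (h : Shallow w Φ {φ}) (h' : Shallow w' Φ {ψ}) :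
    Shallow (w + w') Φ {fun x => φ x + ψ x} := by
  refine (h.union h').of_subset (Set.singleton_subset_iff.2 ?_)
  exact Submodule.add_mem _ (subset_affSpan (by simp)) (subset_affSpan (by simp))

theorem Shallow.const_mul (h : Shallow w Φ {φ}) (c : ℝ) : Shallow w Φ {fun x => c * φ x} :=
  h.of_subset (Set.singleton_subset_iff.2
    ((affSpan {φ}).smul_mem c (subset_affSpan (Set.mem_singleton φ))))

theorem Shallow.sub (h : Shallow w Φ {φ}) (h' : Shallow w' Φ {ψ}) :
    Shallow (w + w') Φ {fun x => φ x - ψ x} := by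
  have := h.add (h'.const_mul (-1))
  simpa [sub_eq_add_neg] using this

theorem shallow_const (Φ : Set (X → ℝ)) (c : ℝ) : Shallow 0 Φ {fun _ => c} :=
  (shallow_empty Φ).of_subset (Set.singleton_subset_iff.2 (const_mem_affSpan _ c))

theorem shallow_sum {n : ℕ} {F : ℕ → X → ℝ} (h : ∀ i < n, Shallow w Φ {F i}) :
    Shallow (n * w) Φ {fun x => ∑ i ∈ Finset.range n, F i x} := by
  induction n with
  | zero => simpa using shallow_const Φ 0
  | succ n ih =>
    have := (ih fun i hi => h i (by omega)).add (h n (by omega))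
    simp only [Finset.sum_range_succ]
    exact this.weaken (by linarith [add_mul n 1 w])

theorem shallow_relu (h : φ ∈ affSpan Φ) : Shallow 1 Φ {fun x => relu (φ x)} :=
  ⟨{φ}, by simp, by simpa using h, by
    simpa using subset_affSpan (Set.mem_singleton (fun x => relu (φ x)))⟩

theorem shallow_affine (h : φ ∈ affSpan Φ) : Shallow 2 Φ {φ} := by
  have := (shallow_relu h).sub (shallow_relu ((affSpan Φ).neg_mem h))
  convert this using 3
  rename_i x
  simp only [relu, Pi.neg_apply]
  rcases le_total (φ x) 0 with h | h
  · rw [max_eq_right h, max_eq_left (by linarith)]; ring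
  · rw [max_eq_left h, max_eq_right (by linarith)]; ring

theorem affSpan_add (hφ : φ ∈ affSpan Φ) (hψ : ψ ∈ affSpan Φ) :
    (fun x => φ x + ψ x) ∈ affSpan Φ := Submodule.add_mem _ hφ hψ

theorem affSpan_sub (hφ : φ ∈ affSpan Φ) (hψ : ψ ∈ affSpan Φ) :
    (fun x => φ x - ψ x) ∈ affSpan Φ := Submodule.sub_mem _ hφ hψ

theorem affSpan_const_mul (c : ℝ) (hφ : φ ∈ affSpan Φ) :
    (fun x => c * φ x) ∈ affSpan Φ := Submodule.smul_mem _ c hφ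

theorem affSpan_sum {ι : Type*} {s : Finset ι} {F : ι → X → ℝ} (h : ∀ i ∈ s, F i ∈ affSpan Φ) :
    (fun x => ∑ i ∈ s, F i x) ∈ affSpan Φ := by
  have := Submodule.sum_mem _ h
  convert this using 1
  ext x
  simp

/-- The ramp of unit width below an integer is the indicator function of a half-line, on integers.
-/
theorem relu_sub_relu_int (a b : ℤ) :
    relu ((a : ℝ) - b + 1) - relu ((a : ℝ) - b) = if b ≤ a then 1 else 0 := by
  unfold relu
  split_ifs with h
  · have : (b : ℝ) ≤ a := by exact_mod_cast h
    rw [max_eq_left (by linarith), max_eq_left (by linarith)]; ring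
  · have : (a : ℝ) + 1 ≤ b := by exact_mod_cast not_le.1 h
    rw [max_eq_right (by linarith), max_eq_right (by linarith)]; ring

theorem shallow_threshold {a : X → ℤ} (h : (fun x => (a x : ℝ)) ∈ affSpan Φ) (b : ℤ) :
    Shallow 2 Φ {fun x => if b ≤ a x then (1 : ℝ) else 0} := by
  have h1 := affSpan_sub h (const_mem_affSpan Φ b)
  have := (shallow_relu (affSpan_add h1 (const_mem_affSpan Φ 1))).sub (shallow_relu h1)
  simpa only [relu_sub_relu_int] using this

theorem shallow_eq_zero {a : X → ℤ} (h : (fun x => (a x : ℝ)) ∈ affSpan Φ) :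
    Shallow 4 Φ {fun x => if a x = 0 then (1 : ℝ) else 0} := by
  have := (shallow_threshold h 0).sub (shallow_threshold h 1)
  convert this using 3
  rename_i x
  split_ifs <;> first | omega | simp

/-- Multiplication of a bounded quantity by an indicator `e`. -/
theorem shallow_gate {v e : X → ℝ} (hv : v ∈ affSpan Φ) (he : e ∈ affSpan Φ) (C : ℝ)
    (hvC : ∀ x, |v x| ≤ C) (he' : ∀ x, e x = 0 ∨ 1 ≤ e x) :
    Shallow 2 Φ {fun x => if e x = 0 then v x else 0} := by
  have h1 := affSpan_const_mul C he
  have := (shallow_relu (affSpan_sub hv h1)).sub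
    (shallow_relu (affSpan_sub (affSpan_const_mul (-1) hv) h1))
  convert this using 3
  rename_i x
  have hv := abs_le.1 (hvC x)
  unfold relu
  split_ifs with h
  · rw [h]
    rcases le_total (v x) 0 with h | h
    · rw [max_eq_right (by linarith), max_eq_left (by linarith)]; ring
    · rw [max_eq_left (by linarith), max_eq_right (by linarith)]; ring
  · have h1 := (he' x).resolve_left h
    have hC : 0 ≤ C := (abs_nonneg _).trans (hvC x)
    have : C ≤ C * e x := le_mul_of_one_le_right hC h1
    rw [max_eq_right (by linarith), max_eq_right (by linarith)]; ring

end Reach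

section Decoder

variable {X : Type*} {inp : X → ℝ} {W L : ℕ}

theorem sum_thresholds_eq_div {a k w : ℕ} (hw : 0 < w) (ha : a < (k + 1) * w) :
    ∑ j ∈ Finset.range k, (if (j + 1) * w ≤ a then 1 else 0) = a / w := by
  have h1 : a / w < k + 1 := (Nat.div_lt_iff_lt_mul hw).2 ha
  rw [Finset.sum_ite, Finset.sum_const_zero, add_zero, Finset.sum_const, smul_eq_mul, mul_one]
  have : (Finset.range k).filter (fun j => (j + 1) * w ≤ a) = Finset.range (a / w) := by
    ext j
    rw [Finset.mem_filter, Finset.mem_range, Finset.mem_range, ← Nat.le_div_iff_mul_le hw]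
    omega
  rw [this, Finset.card_range]

theorem div_eq_add_sum_thresholds (R : ℕ) {k w : ℕ} (hw : 0 < w) :
    R / w = (k + 1) * (R / ((k + 1) * w)) +
      ∑ j ∈ Finset.range k, (if (j + 1) * w ≤ R % ((k + 1) * w) then 1 else 0) := by
  rw [sum_thresholds_eq_div hw (Nat.mod_lt _ (by positivity))]
  conv_lhs => rw [← Nat.div_add_mod R ((k + 1) * w)]
  rw [show (k + 1) * w * (R / ((k + 1) * w)) = w * ((k + 1) * (R / ((k + 1) * w))) by ring,
    Nat.mul_add_div hw]

/-- One layer reads the next digit of `R` in base `2 * m + 1`, and computes the indicator of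
`o = 0`. -/
theorem Reach.digit {m w : ℕ} (hw : 0 < w) (hW : 4 * m + 13 ≤ W) {o : X → ℤ} {R : X → ℕ}
    {y : X → ℝ}
    (h : Reach inp W L {fun x => (o x : ℝ), fun x => (R x : ℝ),
      fun x => ((R x / ((2 * m + 1) * w) : ℕ) : ℝ), y}) :
    Reach inp W (L + 1) {fun x => (o x : ℝ), fun x => (R x : ℝ),
      fun x => ((R x / w : ℕ) : ℝ), y, fun x => if o x = 0 then (1 : ℝ) else 0} := by
  set Φ : Set (X → ℝ) := {fun x => (o x : ℝ), fun x => (R x : ℝ),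
    fun x => ((R x / ((2 * m + 1) * w) : ℕ) : ℝ), y} with hΦ
  have ho : (fun x => (o x : ℝ)) ∈ affSpan Φ := subset_affSpan (by simp [hΦ])
  have hR : (fun x => (R x : ℝ)) ∈ affSpan Φ := subset_affSpan (by simp [hΦ])
  have hp : (fun x => ((R x / ((2 * m + 1) * w) : ℕ) : ℝ)) ∈ affSpan Φ :=
    subset_affSpan (by simp [hΦ])
  have hy : y ∈ affSpan Φ := subset_affSpan (by simp [hΦ])
  have hmod : (fun x => (((R x % ((2 * m + 1) * w) : ℕ) : ℤ) : ℝ)) ∈ affSpan Φ := by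
    convert affSpan_sub hR (affSpan_const_mul (((2 * m + 1) * w : ℕ) : ℝ) hp) using 2 with x
    rw [eq_sub_iff_add_eq]
    rw [Int.cast_natCast, ← Nat.cast_mul, ← Nat.cast_add, Nat.mod_add_div]
  have hd := (shallow_affine (affSpan_const_mul ((2 * m + 1 : ℕ) : ℝ) hp)).add
    (shallow_sum (n := 2 * m) fun j _ => shallow_threshold hmod (((j + 1) * w : ℕ) : ℤ))
  have hd' : Shallow (2 + 2 * m * 2) Φ {fun x => ((R x / w : ℕ) : ℝ)} := by
    convert hd using 3 with x
    rw [div_eq_add_sum_thresholds (R x) (k := 2 * m) hw]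
    simp only [Nat.cast_le]
    push_cast
    rfl
  exact h.step ((shallow_affine ho).insert ((shallow_affine hR).insert
    (hd'.insert ((shallow_affine hy).insert (shallow_eq_zero ho))))) (by omega)

theorem Reach.digits {m U T : ℕ} (hU : 0 < U) (hW : 4 * m + 13 ≤ W) {o : X → ℤ} {R : X → ℕ}
    {y : X → ℝ} (hR : ∀ x, R x < (2 * m + 1) ^ (T + 1) * U)
    (h : Reach inp W L {fun x => (o x : ℝ), fun x => (R x : ℝ), y}) :
    Reach inp W (L + (T + 1)) {fun x => (o x : ℝ), fun x => (R x : ℝ),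
      fun x => ((R x / U : ℕ) : ℝ), y, fun x => if o x = 0 then (1 : ℝ) else 0} := by
  have key : ∀ i ≤ T, Reach inp W (L + i) {fun x => (o x : ℝ), fun x => (R x : ℝ),
      fun x => ((R x / ((2 * m + 1) * ((2 * m + 1) ^ (T - i) * U)) : ℕ) : ℝ), y} := by
    intro i
    induction i with
    | zero =>
      intro _
      refine h.of_subset ?_
      have : ∀ x, R x / ((2 * m + 1) * ((2 * m + 1) ^ (T - 0) * U)) = 0 := fun x =>
        Nat.div_eq_of_lt (by
          have := hR x
          rw [pow_succ'] at this
          simpa [mul_assoc] using this)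
      simp only [this]
      simp only [Set.insert_subset_iff, Set.singleton_subset_iff]
      refine ⟨subset_affSpan (by simp), subset_affSpan (by simp), const_mem_affSpan _ _,
        subset_affSpan (by simp)⟩
    | succ i ih =>
      intro hi
      have := (ih (by omega)).digit (w := (2 * m + 1) ^ (T - i) * U) (by positivity) hW
      rw [show T - i = T - (i + 1) + 1 by omega, pow_succ', mul_assoc] at this
      refine Reach.of_subset this fun φ hφ => subset_affSpan ?_
      simp only [Set.mem_insert_iff, Set.mem_singleton_iff] at hφ ⊢
      tauto
  have := (key T le_rfl).digit (w := (2 * m + 1) ^ (T - T) * U) (by positivity) hW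
  simpa [add_assoc] using this

/-- Reading one piece `(f, d)` off the front of the code `R`. -/
theorem Reach.piece {m U T : ℕ} {B : ℤ} (hU : 0 < U) (hT : 1 ≤ T) (hW : 4 * m + 13 ≤ W)
    {o : X → ℤ} {R R' f d : X → ℕ} {y : X → ℤ} (hf : ∀ x, f x ≤ 1)
    (hd : ∀ x, d x < (2 * m + 1) ^ T) (hR' : ∀ x, R' x < U)
    (hR : ∀ x, R x = (f x * (2 * m + 1) ^ T + d x) * U + R' x)
    (h : Reach inp W L {fun x => (o x : ℝ), fun x => (R x : ℝ), fun x => (y x : ℝ)}) :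
    Reach inp W (L + (T + 2)) {fun x => ((o x - f x : ℤ) : ℝ), fun x => (R' x : ℝ),
      fun x => ((y x + if o x - f x = 0 then (d x - B : ℤ) else 0 : ℤ) : ℝ)} := by
  obtain ⟨T, rfl⟩ : ∃ T', T = T' + 1 := ⟨T - 1, by omega⟩
  have hlt : ∀ x, d x * U + R' x < (2 * m + 1) ^ (T + 1) * U := fun x =>
    calc d x * U + R' x < d x * U + U := by have := hR' x; omega
      _ = (d x + 1) * U := by ring
      _ ≤ _ := Nat.mul_le_mul_right _ (hd x)
  have h1 : Reach inp W (L + 1) {fun x => ((o x - f x : ℤ) : ℝ),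
      fun x => ((d x * U + R' x : ℕ) : ℝ), fun x => (y x : ℝ)} := by
    set Φ : Set (X → ℝ) := {fun x => (o x : ℝ), fun x => (R x : ℝ), fun x => (y x : ℝ)} with hΦ
    have ho : (fun x => (o x : ℝ)) ∈ affSpan Φ := subset_affSpan (by simp [hΦ])
    have hRm : (fun x => (((R x : ℕ) : ℤ) : ℝ)) ∈ affSpan Φ := subset_affSpan (by simp [hΦ])
    have hy : (fun x => (y x : ℝ)) ∈ affSpan Φ := subset_affSpan (by simp [hΦ])
    have hflag : Shallow 2 Φ {fun x => (f x : ℝ)} := by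
      convert shallow_threshold hRm (((2 * m + 1) ^ (T + 1) * U : ℕ) : ℤ) using 3 with x
      have := hlt x
      simp only [Nat.cast_le, hR x, add_mul, add_assoc]
      rcases Nat.le_one_iff_eq_zero_or_eq_one.1 (hf x) with h0 | h0
      · rw [h0, if_neg (by rw [not_le]; simpa using this)]; simp
      · rw [h0, if_pos (by rw [one_mul]; exact Nat.le_add_right _ _)]; simp
    have ho' : Shallow 4 Φ {fun x => ((o x - f x : ℤ) : ℝ)} := by
      simpa using (shallow_affine ho).sub hflag
    have hR1 : Shallow 4 Φ {fun x => ((d x * U + R' x : ℕ) : ℝ)} := by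
      convert (shallow_affine hRm).sub
        (hflag.const_mul (((2 * m + 1) ^ (T + 1) * U : ℕ) : ℝ)) using 3 with x
      rw [hR x]
      push_cast
      ring
    exact h.step (ho'.insert (hR1.insert (shallow_affine hy))) (by omega)
  have h2 := h1.digits hU hW hlt
  have hdiv : ∀ x, (d x * U + R' x) / U = d x := fun x => by
    rw [mul_comm, Nat.mul_add_div hU, Nat.div_eq_of_lt (hR' x), add_zero]
  simp only [hdiv] at h2
  set e : X → ℝ := fun x => if o x - f x = 0 then (1 : ℝ) else 0 with he
  set Φ : Set (X → ℝ) := {fun x => ((o x - f x : ℤ) : ℝ), fun x => ((d x * U + R' x : ℕ) : ℝ),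
    fun x => (d x : ℝ), fun x => (y x : ℝ), e} with hΦ
  have ho : (fun x => ((o x - f x : ℤ) : ℝ)) ∈ affSpan Φ := subset_affSpan (by simp [hΦ])
  have hRm : (fun x => ((d x * U + R' x : ℕ) : ℝ)) ∈ affSpan Φ := subset_affSpan (by simp [hΦ])
  have hdm : (fun x => (d x : ℝ)) ∈ affSpan Φ := subset_affSpan (by simp [hΦ])
  have hy : (fun x => (y x : ℝ)) ∈ affSpan Φ := subset_affSpan (by simp [hΦ])
  have hem : e ∈ affSpan Φ := subset_affSpan (by simp [hΦ])
  have hgate := shallow_gate (affSpan_sub hdm (const_mem_affSpan Φ (B : ℝ)))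
    (affSpan_sub (const_mem_affSpan Φ 1) hem) (((2 * m + 1 : ℕ) : ℝ) ^ (T + 1) + |(B : ℝ)|)
    (fun x => by
      refine (abs_sub _ _).trans (add_le_add ?_ le_rfl)
      rw [abs_of_nonneg (Nat.cast_nonneg _)]
      exact_mod_cast (hd x).le)
    (fun x => by
      simp only [he]
      split_ifs <;> simp)
  have hy' : Shallow 4 Φ
      {fun x => ((y x + if o x - f x = 0 then (d x - B : ℤ) else 0 : ℤ) : ℝ)} := by
    convert (shallow_affine hy).add hgate using 3 with x
    simp only [he]
    split_ifs <;> simp_all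
  have hR2 : Shallow 2 Φ {fun x => (R' x : ℝ)} := by
    convert shallow_affine (affSpan_sub hRm (affSpan_const_mul (U : ℝ) hdm)) using 3 with x
    push_cast
    ring
  rw [show L + (T + 1 + 2) = L + 1 + (T + 1) + 1 by ring]
  exact h2.step ((shallow_affine ho).insert (hR2.insert hy')) (by omega)

/-- The code of the pieces `(f g, d g), …, (f (g + r - 1), d (g + r - 1))`, where `d < q`. -/
def pieceCode (q : ℕ) (f d : ℕ → ℕ) : ℕ → ℕ → ℕ
  | 0, _ => 0
  | r + 1, g => (f g * q + d g) * (2 * q) ^ r + pieceCode q f d r (g + 1)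

theorem pieceCode_lt {q : ℕ} {f d : ℕ → ℕ} (hf : ∀ g, f g ≤ 1) (hd : ∀ g, d g < q) (r g : ℕ) :
    pieceCode q f d r g < (2 * q) ^ r := by
  induction r generalizing g with
  | zero => simp [pieceCode]
  | succ r ih =>
    have h1 : f g * q + d g + 1 ≤ 2 * q := by
      have := Nat.mul_le_mul_right q (hf g)
      have := hd g
      omega
    calc (f g * q + d g) * (2 * q) ^ r + pieceCode q f d r (g + 1)
        < (f g * q + d g) * (2 * q) ^ r + (2 * q) ^ r := Nat.add_lt_add_left (ih _) _
      _ = (f g * q + d g + 1) * (2 * q) ^ r := by ring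
      _ ≤ 2 * q * (2 * q) ^ r := Nat.mul_le_mul_right _ h1
      _ = _ := (pow_succ' _ _).symm

/-- Reading `r` consecutive pieces, with the offset and output of the intermediate stages given
by the functions `o t` and `y t`. -/
theorem Reach.pieces {m T r : ℕ} {B : ℤ} (hT : 1 ≤ T) (hW : 4 * m + 13 ≤ W)
    {f d : ℕ → ℕ} (hf : ∀ g, f g ≤ 1) (hd : ∀ g, d g < (2 * m + 1) ^ T) (g : X → ℕ)
    (o y : ℕ → X → ℤ) (ho : ∀ t x, o (t + 1) x = o t x - f (g x + t))
    (hy : ∀ t x, y (t + 1) x = y t x + if o (t + 1) x = 0 then (d (g x + t) - B : ℤ) else 0)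
    (h : Reach inp W L {fun x => (o 0 x : ℝ),
      fun x => (pieceCode ((2 * m + 1) ^ T) f d r (g x) : ℝ), fun x => (y 0 x : ℝ)}) :
    Reach inp W (L + r * (T + 2)) {fun x => (y r x : ℝ)} := by
  suffices H : ∀ t ≤ r, Reach inp W (L + t * (T + 2)) {fun x => (o t x : ℝ),
      fun x => (pieceCode ((2 * m + 1) ^ T) f d (r - t) (g x + t) : ℝ),
      fun x => (y t x : ℝ)} from
    (H r le_rfl).of_subset (Set.singleton_subset_iff.2 (subset_affSpan (by simp)))
  intro t
  induction t with
  | zero => intro _; simpa using h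
  | succ t ih =>
    intro ht
    obtain ⟨s, hs⟩ : ∃ s, r - t = s + 1 := ⟨r - t - 1, by omega⟩
    have h1 := ih (by omega)
    rw [hs] at h1
    have := h1.piece (B := B) (U := (2 * (2 * m + 1) ^ T) ^ s)
      (R' := fun x => pieceCode ((2 * m + 1) ^ T) f d s (g x + t + 1))
      (f := fun x => f (g x + t)) (d := fun x => d (g x + t)) (by positivity) hT hW
      (fun x => hf _) (fun x => hd _) (fun x => pieceCode_lt hf hd _ _) (fun x => rfl)
    simp only [← ho, ← hy] at this
    rw [show r - (t + 1) = s by omega, show L + (t + 1) * (T + 2) = L + t * (T + 2) + (T + 2) by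
      ring]
    exact this

end Decoder

section Lookup

variable {X : Type*} {inp : X → ℝ} {W L : ℕ}

/-- A sum over disjoint blocks commutes with functions vanishing at zero. -/
theorem apply_sum_blocks {f : ℝ → ℝ} (hf : f 0 = 0) (b m k c : ℕ) (a : ℕ → ℝ) :
    f (∑ i ∈ Finset.range k, if b + i * m < c ∧ c ≤ b + (i + 1) * m then a i else 0) =
      ∑ i ∈ Finset.range k, if b + i * m < c ∧ c ≤ b + (i + 1) * m then f (a i) else 0 := by
  by_cases h : ∃ i ∈ Finset.range k, b + i * m < c ∧ c ≤ b + (i + 1) * m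
  · obtain ⟨i, hi, h1, h2⟩ := h
    have huniq : ∀ j, j ≠ i → ¬ (b + j * m < c ∧ c ≤ b + (j + 1) * m) := by
      rintro j hj ⟨h3, h4⟩
      have h5 : i < j + 1 := Nat.lt_of_mul_lt_mul_right (a := m) (by omega)
      have h6 : j < i + 1 := Nat.lt_of_mul_lt_mul_right (a := m) (by omega)
      omega
    rw [Finset.sum_eq_single_of_mem i hi fun j _ hj => if_neg (huniq j hj),
      Finset.sum_eq_single_of_mem i hi fun j _ hj => if_neg (huniq j hj),
      if_pos ⟨h1, h2⟩, if_pos ⟨h1, h2⟩]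
  · push Not at h
    rw [Finset.sum_eq_zero fun i hi => if_neg fun h' => (h i hi h'.1).not_ge h'.2,
      Finset.sum_eq_zero fun i hi => if_neg fun h' => (h i hi h'.1).not_ge h'.2, hf]

theorem sum_increments_eq (V : ℕ → ℝ) (b k c : ℕ) (hb : b ≤ c) :
    V (min c (b + k)) =
      V b + ∑ j ∈ Finset.range k, (if b + j < c then V (b + j + 1) - V (b + j) else 0) := by
  induction k with
  | zero => simp [hb]
  | succ k ih =>
    rw [Finset.sum_range_succ, ← add_assoc (V b), ← ih]
    split_ifs with h
    · rw [min_eq_right (by omega), min_eq_right (by omega), ← add_assoc]; ring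
    · rw [min_eq_left (by omega), min_eq_left (by omega)]; ring

/-- Two-level expansion of a step function. -/
theorem eq_add_sum_blocks (V : ℕ → ℝ) (b m k c : ℕ) :
    V (min c (b + k * m)) = (V (min c b) + ∑ i ∈ Finset.range k,
        (if b + (i + 1) * m < c then (1 : ℝ) else 0) * (V (b + (i + 1) * m) - V (b + i * m))) +
      ∑ j ∈ Finset.range m, ∑ i ∈ Finset.range k,
        if b + i * m < c ∧ c ≤ b + (i + 1) * m then
          (if b + i * m + j < c then V (b + i * m + j + 1) - V (b + i * m + j) else 0) else 0 := by
  rw [Finset.sum_comm, add_assoc, ← Finset.sum_add_distrib]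
  induction k with
  | zero => simp
  | succ k ih =>
    rw [Finset.sum_range_succ, ← add_assoc, ← ih]
    have hk : b + (k + 1) * m = b + k * m + m := by ring
    rw [hk]
    by_cases h1 : b + k * m < c
    · by_cases h2 : c ≤ b + k * m + m
      · simp only [h1, h2, and_self, if_true, if_neg h2.not_gt]
        rw [min_eq_right h1.le, sum_increments_eq V (b + k * m) m c h1.le]
        ring
      · simp only [h1, h2, and_false, if_false, if_pos (not_le.1 h2), Finset.sum_const_zero]
        rw [min_eq_right h1.le, min_eq_right (by omega)]
        ring
    · simp only [h1, false_and, if_false, Finset.sum_const_zero]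
      rw [min_eq_left (by omega), min_eq_left (by omega), if_neg (by omega)]
      ring

theorem relu_zero : relu 0 = 0 := max_self 0

theorem relu_mul_of_nonneg {a : ℝ} (ha : 0 ≤ a) (t : ℝ) : relu (a * t) = a * relu t := by
  unfold relu
  rw [mul_max_of_nonneg _ _ ha, mul_zero]

theorem mul_threshold_eq (δ : ℝ) (p u : ℕ) :
    (if u ≤ p then δ else 0) =
      relu (relu δ * ((p : ℝ) - u + 1)) - relu (relu δ * ((p : ℝ) - u)) -
        (relu (relu (-δ) * ((p : ℝ) - u + 1)) - relu (relu (-δ) * ((p : ℝ) - u))) := by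
  have h0 : ∀ t, 0 ≤ relu t := fun t => le_max_right _ _
  have hδ : δ = relu δ - relu (-δ) := by
    unfold relu
    rcases le_total δ 0 with h | h
    · rw [max_eq_right h, max_eq_left (by linarith)]; ring
    · rw [max_eq_left h, max_eq_right (by linarith)]; ring
  have h1 := relu_sub_relu_int p u
  push_cast at h1
  rw [relu_mul_of_nonneg (h0 _), relu_mul_of_nonneg (h0 _), relu_mul_of_nonneg (h0 _),
    relu_mul_of_nonneg (h0 _), ← mul_sub, ← mul_sub, h1, ← sub_mul, ← hδ]
  simp only [Nat.cast_le]
  split_ifs <;> ring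

/-- Two layers of width `O(m)` advance the tabulation of functions of `c` by `m * m` values. -/
theorem Reach.lookup_stage {m n b : ℕ} {pos c : X → ℕ} {V : Fin n → ℕ → ℝ}
    (hW1 : 5 * m + 2 * n + 8 ≤ W) (hW2 : n * (4 * m + 2) + 3 ≤ W)
    (hc : ∀ q, ∃ u : ℕ, ∀ x, q < c x ↔ u ≤ pos x)
    (h : Reach inp W L (insert (fun x => (pos x : ℝ))
      (Set.range fun k x => V k (min (c x) b)))) :
    Reach inp W (L + 2) (insert (fun x => (pos x : ℝ))
      (Set.range fun k x => V k (min (c x) (b + m * m)))) := by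
  choose u hu using hc
  set Φ : Set (X → ℝ) := insert (fun x => (pos x : ℝ))
      (Set.range fun k x => V k (min (c x) b)) with hΦ
  have hpos : (fun x => (pos x : ℝ)) ∈ affSpan Φ := subset_affSpan (Set.mem_insert _ _)
  have hposZ : (fun x => ((pos x : ℤ) : ℝ)) ∈ affSpan Φ := by simpa using hpos
  have hV : ∀ k, (fun x => V k (min (c x) b)) ∈ affSpan Φ := fun k =>
    subset_affSpan (Set.mem_insert_of_mem _ ⟨k, rfl⟩)
  let H : ℕ → X → ℝ := fun i x => if b + i * m < c x then 1 else 0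
  let G : ℕ → X → ℝ := fun i x => if b + i * m < c x then (pos x : ℝ) else 0
  have hH : ∀ i, Shallow 2 Φ {H i} := fun i => by
    simpa [H, hu] using shallow_threshold hposZ (u (b + i * m))
  have hG : ∀ i, Shallow 3 Φ {G i} := fun i => by
    have := (shallow_relu (affSpan_sub hpos (const_mem_affSpan Φ (u (b + i * m))))).add
      ((hH i).const_mul (u (b + i * m)))
    convert this using 3 with x
    simp only [G, H, hu, relu]
    split_ifs with h
    · have : (u (b + i * m) : ℝ) ≤ pos x := by exact_mod_cast h
      rw [max_eq_left (by linarith)]; ring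
    · have : (pos x : ℝ) ≤ u (b + i * m) := by exact_mod_cast (not_le.1 h).le
      rw [max_eq_right (by linarith)]; ring
  set Ψ : Set (X → ℝ) := insert (fun x => (pos x : ℝ))
      ((Set.range fun k x => V k (min (c x) b)) ∪
        ((Set.range fun i : Fin (m + 1) => H i) ∪ Set.range fun i : Fin (m + 1) => G i)) with hΨ
  have h1 : Reach inp W (L + 1) Ψ :=
    h.step ((shallow_affine hpos).insert ((shallow_range fun k => shallow_affine (hV k)).union
      ((shallow_range fun i => hH i).union (shallow_range fun i => hG i)))) (by linarith)
  have hpos' : (fun x => (pos x : ℝ)) ∈ affSpan Ψ := subset_affSpan (Set.mem_insert _ _)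
  have hV' : ∀ k, (fun x => V k (min (c x) b)) ∈ affSpan Ψ := fun k =>
    subset_affSpan (Or.inr (Or.inl ⟨k, rfl⟩))
  have hH' : ∀ i ≤ m, H i ∈ affSpan Ψ := fun i hi =>
    subset_affSpan (Or.inr (Or.inr (Or.inl ⟨⟨i, by omega⟩, rfl⟩)))
  have hG' : ∀ i ≤ m, G i ∈ affSpan Ψ := fun i hi =>
    subset_affSpan (Or.inr (Or.inr (Or.inr ⟨⟨i, by omega⟩, rfl⟩)))
  have hblock : ∀ α β : ℕ → ℝ, (fun x => ∑ i ∈ Finset.range m,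
      if b + i * m < c x ∧ c x ≤ b + (i + 1) * m then α i * (pos x + β i) else 0) ∈
        affSpan Ψ := by
    intro α β
    refine affSpan_sum fun i hi => ?_
    have hi' := Finset.mem_range.1 hi
    have := affSpan_const_mul (α i) (affSpan_add
      (affSpan_sub (hG' i hi'.le) (hG' (i + 1) hi'))
      (affSpan_const_mul (β i) (affSpan_sub (hH' i hi'.le) (hH' (i + 1) hi'))))
    convert this using 2 with x
    simp only [G, H]
    have : i * m ≤ (i + 1) * m := Nat.mul_le_mul_right _ (by omega)
    split_ifs <;> first | omega | ring
  have hloc : ∀ (k : Fin n) (j : ℕ), Shallow 4 Ψ {fun x => ∑ i ∈ Finset.range m,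
      if b + i * m < c x ∧ c x ≤ b + (i + 1) * m then
        (if b + i * m + j < c x then V k (b + i * m + j + 1) - V k (b + i * m + j) else 0)
          else 0} := by
    intro k j
    set δ : ℕ → ℝ := fun i => V k (b + i * m + j + 1) - V k (b + i * m + j)
    have hr : ∀ α β : ℕ → ℝ, Shallow 1 Ψ {fun x => ∑ i ∈ Finset.range m,
        if b + i * m < c x ∧ c x ≤ b + (i + 1) * m then relu (α i * (pos x + β i)) else 0} := by
      intro α β
      simpa only [apply_sum_blocks relu_zero] using shallow_relu (hblock α β)
    have := ((hr (fun i => relu (δ i)) fun i => 1 - u (b + i * m + j)).sub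
      (hr (fun i => relu (δ i)) fun i => - u (b + i * m + j))).sub
      ((hr (fun i => relu (-δ i)) fun i => 1 - u (b + i * m + j)).sub
      (hr (fun i => relu (-δ i)) fun i => - u (b + i * m + j)))
    convert this using 3 with x
    rw [← Finset.sum_sub_distrib, ← Finset.sum_sub_distrib, ← Finset.sum_sub_distrib]
    refine Finset.sum_congr rfl fun i _ => ?_
    by_cases hi : b + i * m < c x ∧ c x ≤ b + (i + 1) * m
    · simp only [hi, and_self, if_true, hu]
      rw [mul_threshold_eq,
        show (pos x : ℝ) - u (b + i * m + j) + 1 = pos x + (1 - u (b + i * m + j)) by ring,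
        sub_eq_add_neg (pos x : ℝ)]
    · simp only [hi, if_false]
      ring
  have hnew : ∀ k, Shallow (4 * m + 2) Ψ {fun x => V k (min (c x) (b + m * m))} := by
    intro k
    have hbase := affSpan_add (hV' k) (affSpan_sum (s := Finset.range m) fun i hi =>
      affSpan_const_mul (V k (b + (i + 1) * m) - V k (b + i * m))
        (hH' (i + 1) (Finset.mem_range.1 hi)))
    have := (shallow_affine hbase).add (shallow_sum (n := m) fun j _ => hloc k j)
    refine Shallow.weaken (w := 2 + m * 4) ?_ (by omega)
    convert this using 3 with x
    rw [eq_add_sum_blocks (V k) b m m (c x)]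
    simp only [H, mul_comm]
  exact h1.step ((shallow_affine hpos').insert (shallow_range hnew)) (by linarith)

/-- `2 * D` layers of width `O(m)` tabulate functions of `c`, when `c` takes few values. -/
theorem Reach.lookup {m n : ℕ} (D : ℕ) {pos c : X → ℕ} {V : Fin n → ℕ → ℝ}
    (hW1 : 5 * m + 2 * n + 8 ≤ W) (hW2 : n * (4 * m + 2) + 3 ≤ W)
    (hc : ∀ q, ∃ u : ℕ, ∀ x, q < c x ↔ u ≤ pos x) (hcD : ∀ x, c x ≤ D * (m * m))
    (h : Reach inp W L {fun x => (pos x : ℝ)}) :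
    Reach inp W (L + 2 * D) (insert (fun x => (pos x : ℝ)) (Set.range fun k x => V k (c x))) := by
  have key : ∀ t, Reach inp W (L + 2 * t) (insert (fun x => (pos x : ℝ))
      (Set.range fun k x => V k (min (c x) (t * (m * m))))) := by
    intro t
    induction t with
    | zero =>
      refine h.of_subset (Set.insert_subset (subset_affSpan (by simp)) ?_)
      rintro _ ⟨k, rfl⟩
      simpa using const_mem_affSpan _ _
    | succ t ih =>
      have := ih.lookup_stage hW1 hW2 hc
      rw [add_mul, one_mul]
      exact this
  simpa only [min_eq_left (hcD _)] using key D

end Lookup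

section Blocks

variable {A : ℕ → ℕ}

theorem exists_block_index (hA : StrictMono A) (hA0 : A 0 = 0) :
    ∃ own : ℕ → ℕ, ∀ g n, own g = n ↔ A n ≤ g ∧ g < A (n + 1) := by
  have hex : ∀ g, ∃ n, g < A (n + 1) := fun g => ⟨g, hA.id_le (g + 1)⟩
  have h1 : ∀ g, A (Nat.find (hex g)) ≤ g := fun g => by
    rcases Nat.eq_zero_or_pos (Nat.find (hex g)) with h | h
    · rw [h, hA0]; exact Nat.zero_le _
    · have := Nat.find_min (hex g) (m := Nat.find (hex g) - 1) (by omega)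
      rw [Nat.sub_add_cancel h] at this
      exact not_lt.1 this
  refine ⟨fun g => Nat.find (hex g), fun g n => ⟨?_, fun ⟨h2, h3⟩ => ?_⟩⟩
  · rintro rfl
    exact ⟨h1 g, Nat.find_spec (hex g)⟩
  · have h4 := hA.lt_iff_lt.1 ((h1 g).trans_lt h3)
    have h5 := hA.lt_iff_lt.1 (h2.trans_lt (Nat.find_spec (hex g)))
    show Nat.find (hex g) = n
    omega

theorem block_index_step (hA : StrictMono A) {own : ℕ → ℕ}
    (hown : ∀ g n, own g = n ↔ A n ≤ g ∧ g < A (n + 1)) (g : ℕ) :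
    own g ≤ own (g + 1) ∧ own (g + 1) ≤ own g + 1 := by
  obtain ⟨h1, h2⟩ := (hown g _).1 rfl
  by_cases h : g + 1 < A (own g + 1)
  · have := (hown (g + 1) (own g)).2 ⟨by omega, h⟩
    omega
  · have := (hown (g + 1) (own g + 1)).2 ⟨by omega, by
      have := hA (Nat.lt_succ_self (own g + 1))
      simp only [Nat.succ_eq_add_one] at this
      omega⟩
    omega

/-- The value `xs n`, truncated to the part transmitted by the pieces of index below `g`, when the
pieces of `n` start at `A n` and each of them carries at most `B`. -/
def transmitted (A : ℕ → ℕ) (B : ℕ) (xs : ℕ → ℤ) (n g : ℕ) : ℤ :=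
  max (-(B * (g - A n : ℕ) : ℕ)) (min (B * (g - A n : ℕ) : ℕ) (xs n))

theorem transmitted_of_le {B : ℕ} {xs : ℕ → ℤ} {n g : ℕ} (h : g ≤ A n) :
    transmitted A B xs n g = 0 := by
  rw [transmitted, Nat.sub_eq_zero_of_le h]
  simp

theorem transmitted_of_ge {B : ℕ} {xs : ℕ → ℤ} {n g : ℕ}
    (hx : (xs n).natAbs ≤ B * (A (n + 1) - A n)) (h : A (n + 1) ≤ g) :
    transmitted A B xs n g = xs n := by
  have : B * (A (n + 1) - A n) ≤ B * (g - A n) := Nat.mul_le_mul_left _ (by omega)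
  rw [transmitted]
  omega

theorem abs_transmitted_succ_sub_le (A : ℕ → ℕ) (B : ℕ) (xs : ℕ → ℤ) (n g : ℕ) :
    |transmitted A B xs n (g + 1) - transmitted A B xs n g| ≤ B := by
  rw [transmitted, transmitted]
  have : B * (g + 1 - A n) = B * (g - A n) ∨ B * (g + 1 - A n) = B * (g - A n) + B := by
    rcases Nat.lt_or_ge g (A n) with h | h
    · left
      congr 1
      omega
    · right
      rw [Nat.sub_add_comm h, mul_add, mul_one]
  rw [abs_le]
  omega

theorem exists_threshold {p : ℕ → Prop} (hp : ∃ n, p n) (hmono : ∀ a b, a ≤ b → p a → p b) :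
    ∃ u, ∀ n, p n ↔ u ≤ n := by
  classical
  exact ⟨Nat.find hp, fun n => ⟨Nat.find_min' hp, fun h => hmono _ _ h (Nat.find_spec hp)⟩⟩

theorem Reach.pad {X : Type*} {inp : X → ℝ} {W L : ℕ} {φ₁ φ₂ φ₃ : X → ℝ} (hW : 7 ≤ W) (k : ℕ)
    (h : Reach inp W L {φ₁, φ₂, φ₃}) : Reach inp W (L + k) {φ₁, φ₂, φ₃} := by
  induction k with
  | zero => exact h
  | succ k ih =>
    exact ih.step ((shallow_affine (subset_affSpan (by simp))).insert
      ((shallow_affine (subset_affSpan (by simp))).insert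
        (shallow_affine (subset_affSpan (by simp))))) hW

/-- Representation of a sequence whose terms are split into pieces of size at most `m ^ T`, `A n`
being the number of pieces of the terms before the `n`-th one. -/
theorem reach_of_pieces {N m T K D : ℕ} (hm : 1 ≤ m) (hT : 1 ≤ T) (hK : 1 ≤ K) {xs : ℕ → ℤ}
    (hA : StrictMono A) (hA0 : A 0 = 0)
    (hx : ∀ n, (xs n).natAbs ≤ m ^ T * (A (n + 1) - A n))
    (hD : A N / (2 * K) ≤ D * (m * m)) :
    Reach (fun x : Fin N => (x : ℝ) + 1) (22 * m + 12)
      (2 * D + 1 + (T + 1) + (2 * K - 1) * (T + 2)) {fun x : Fin N => (xs x : ℝ)} := by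
  obtain ⟨own, hown⟩ := exists_block_index hA hA0
  set P := 2 * K with hP
  have hP0 : 0 < P := by omega
  set B := m ^ T with hB
  set q := (2 * m + 1) ^ T with hq
  have hBq : 2 * B < q := by
    obtain ⟨T, rfl⟩ : ∃ T', T = T' + 1 := ⟨T - 1, by omega⟩
    calc 2 * B = (2 * m) * m ^ T := by rw [hB]; ring
      _ ≤ (2 * m) * (2 * m + 1) ^ T := by gcongr; omega
      _ < (2 * m + 1) * (2 * m + 1) ^ T := by gcongr; omega
      _ = q := by rw [hq]; ring
  let E : ℕ → ℕ → ℤ := transmitted A B xs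
  let f : ℕ → ℕ := fun g => own g - own (g - 1)
  let d : ℕ → ℕ := fun g => (E (own g) (g + 1) - E (own g) g + B).toNat
  have hstep : ∀ g, own (g - 1) ≤ own g ∧ own g ≤ own (g - 1) + 1 := by
    intro g
    rcases Nat.eq_zero_or_pos g with rfl | h
    · simp
    · have := block_index_step hA hown (g - 1)
      rwa [Nat.sub_add_cancel h] at this
  have hf : ∀ g, f g ≤ 1 := fun g => by have := hstep g; simp only [f]; omega
  have hdB : ∀ g, (d g : ℤ) = E (own g) (g + 1) - E (own g) g + B ∧ d g < q := fun g => by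
    have := abs_le.1 (abs_transmitted_succ_sub_le A B xs (own g) g)
    simp only [d, E]
    omega
  let start : ℕ → ℕ := fun j => sInf {n | A (n + 1) / P = j}
  have hstart : ∀ n, A (start (A (n + 1) / P) + 1) / P = A (n + 1) / P := fun n =>
    Nat.sInf_mem (s := {k | A (k + 1) / P = A (n + 1) / P}) ⟨n, rfl⟩
  have hstart_le : ∀ n, start (A (n + 1) / P) ≤ n := fun n => Nat.sInf_le rfl
  let V : Fin 3 → ℕ → ℝ := ![fun j => (start j : ℝ),
    fun j => (pieceCode q f d (2 * K - 1) (A (start j + 1)) : ℝ), fun j => (xs (start j) : ℝ)]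
  have h0 : Reach (fun x : Fin N => (x : ℝ) + 1) (22 * m + 12) 0 {fun x : Fin N => ((x : ℕ) : ℝ)} := by
    refine (reach_input _ _).of_subset (Set.singleton_subset_iff.2 ?_)
    have := affSpan_sub (subset_affSpan (Set.mem_singleton (fun x : Fin N => (x : ℝ) + 1)))
      (const_mem_affSpan _ 1)
    simpa using this
  have h1 := h0.lookup (m := m) (n := 3) D (V := V) (c := fun x : Fin N => A (x + 1) / P) (by omega) (by omega)
    (fun r => by
      obtain ⟨u, hu⟩ := exists_threshold (p := fun n => r < A (n + 1) / P)
        ⟨(r + 1) * P, by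
          rw [← Nat.succ_le_iff, Nat.le_div_iff_mul_le hP0]
          exact (Nat.le_succ _).trans (hA.id_le _)⟩
        (fun a b hab h => h.trans_le (Nat.div_le_div_right (hA.monotone (by omega))))
      exact ⟨u, fun x => hu x⟩)
    (fun x => (Nat.div_le_div_right (hA.monotone x.isLt)).trans hD)
  set Φ := insert (fun x : Fin N => ((x : ℕ) : ℝ))
    (Set.range fun k (x : Fin N) => V k (A (x + 1) / P)) with hΦ
  have hVm : ∀ k, (fun x : Fin N => V k (A (x + 1) / P)) ∈ affSpan Φ := fun k =>
    subset_affSpan (Or.inr ⟨k, rfl⟩)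
  let s : Fin N → ℕ := fun x => start (A (x + 1) / P)
  let g : Fin N → ℕ := fun x => A (s x + 1)
  have hs : (fun x => (s x : ℝ)) ∈ affSpan Φ := hVm 0
  have hcode : (fun x => (pieceCode q f d (2 * K - 1) (g x) : ℝ)) ∈ affSpan Φ := hVm 1
  have hv : (fun x => (xs (s x) : ℝ)) ∈ affSpan Φ := hVm 2
  have ho := affSpan_sub (subset_affSpan (Set.mem_insert _ _) :
    (fun x : Fin N => ((x : ℕ) : ℝ)) ∈ affSpan Φ) hs
  have hgate := shallow_gate hv ho (∑ x, |(xs (s x) : ℝ)|)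
    (fun x => Finset.single_le_sum (f := fun x => |(xs (s x) : ℝ)|)
      (fun _ _ => abs_nonneg _) (Finset.mem_univ x))
    (fun x => by
      rcases (hstart_le x).eq_or_lt with h | h
      · left
        simp only [s, h, sub_self]
      · right
        have : (s x : ℝ) + 1 ≤ (x : ℕ) := by exact_mod_cast h
        linarith)
  let o : ℕ → Fin N → ℤ := fun t x => (x : ℕ) - own (g x + t - 1)
  let y : ℕ → Fin N → ℤ := fun t x => E x (g x + t)
  have hg1 : ∀ x, 1 ≤ g x := fun x => (Nat.le_add_left 1 _).trans (hA.id_le (s x + 1))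
  have hown0 : ∀ x, own (g x - 1) = s x := fun x => (hown _ _).2 ⟨by
      have : A (s x) < A (s x + 1) := hA (Nat.lt_succ_self _)
      simp only [g]
      omega, by have := hg1 x; simp only [g] at this ⊢; omega⟩
  have h2 : Reach (fun x : Fin N => (x : ℝ) + 1) (22 * m + 12) (0 + 2 * D + 1)
      {fun x => (o 0 x : ℝ), fun x => (pieceCode q f d (2 * K - 1) (g x) : ℝ),
        fun x => (y 0 x : ℝ)} := by
    have ho' : Shallow 2 Φ {fun x => (o 0 x : ℝ)} := by
      simpa [o, hown0] using shallow_affine ho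
    have hy' : Shallow 2 Φ {fun x => (y 0 x : ℝ)} := by
      convert hgate using 3 with x
      simp only [y, E, add_zero]
      rcases (hstart_le x).eq_or_lt with h | h
      · have hsx : s x = x := h
        rw [if_pos (by rw [hsx, sub_self]), transmitted_of_ge (hx _) (by simp only [g, hsx, le_refl]),
          hsx]
      · have hsx : s x < x := h
        have : (s x : ℝ) < (x : ℕ) := by exact_mod_cast hsx
        rw [if_neg (by linarith), transmitted_of_le (hA.monotone hsx), Int.cast_zero]
    exact h1.step (ho'.insert ((shallow_affine hcode).insert hy')) (by omega)
  have h3 := (h2.pad (by omega) (T + 1)).pieces (B := B) hT (by omega) hf (fun g => (hdB g).2) g o y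
    (fun t x => by
      have := hstep (g x + t)
      simp only [o, f, ← add_assoc, Nat.add_sub_cancel]
      omega)
    (fun t x => by
      simp only [o, y, ← add_assoc, Nat.add_sub_cancel, (hdB _).1]
      split_ifs with h
      · rw [show own (g x + t) = x by omega]
        ring
      · rw [add_zero]
        by_cases hlt : g x + t < A x
        · simp only [E]
          rw [transmitted_of_le hlt, transmitted_of_le hlt.le]
        · have : ¬ g x + t < A (x + 1) := fun h' =>
            h (by rw [(hown _ _).2 ⟨not_lt.1 hlt, h'⟩, sub_self])
          simp only [E]
          rw [transmitted_of_ge (hx _) (by omega), transmitted_of_ge (hx _) (by omega)])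
  convert h3 using 3 with x
  · ring
  · simp only [y, E]
    rw [transmitted_of_ge (hx _)]
    have h4 : g x / P = A (x + 1) / P := hstart x
    have h5 := Nat.div_add_mod (g x) P
    have h6 := Nat.div_add_mod (A (x + 1)) P
    have h7 := Nat.mod_lt (A (x + 1)) hP0
    rw [h4] at h5
    omega

end Blocks

theorem sum_range_pieces_le {N M B : ℕ} (hB : 0 < B) (hMB : M ≤ N * B) {xs : ℕ → ℤ}
    (hxs : ∑ n ∈ Finset.range N, (xs n).natAbs ≤ M) :
    ∑ n ∈ Finset.range N, ((xs n).natAbs / B + 1) ≤ 2 * N := by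
  have h : (∑ n ∈ Finset.range N, (xs n).natAbs / B) * B ≤ N * B := by
    rw [Finset.sum_mul]
    exact ((Finset.sum_le_sum fun n _ => Nat.div_mul_le_self _ _).trans hxs).trans hMB
  have := Nat.le_of_mul_le_mul_right h hB
  rw [Finset.sum_add_distrib, Finset.sum_const, Finset.card_range, smul_eq_mul, mul_one]
  omega

theorem le_mul_pow_of_ceil_rpow_le {N M T m : ℕ} (hN : 1 ≤ N) (hT : 1 ≤ T)
    (hm : ⌈((M : ℝ) / N) ^ ((T : ℝ)⁻¹)⌉₊ ≤ m) : M ≤ N * m ^ T := by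
  have hN' : (0 : ℝ) < N := by exact_mod_cast hN
  have h1 : ((M : ℝ) / N) ^ ((T : ℝ)⁻¹) ≤ m := Nat.ceil_le.1 hm
  have h2 : (M : ℝ) / N ≤ (m : ℝ) ^ T := by
    rw [← Real.rpow_inv_natCast_pow (x := (M : ℝ) / N) (by positivity) (by omega : T ≠ 0)]
    exact pow_le_pow_left₀ (by positivity) h1 T
  rw [div_le_iff₀ hN', mul_comm] at h2
  exact_mod_cast h2

theorem le_mul_of_ceil_le {N M S T K m : ℕ} (hN : 1 ≤ N) (hM : 1 ≤ M) (hS : 1 ≤ S)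
    (hK : ⌈(S * N : ℝ) / M⌉₊ ≤ K) (hm : ⌈(M : ℝ) / (S * Real.sqrt (N * (T + 2)))⌉₊ ≤ m) :
    N ≤ K * (K * (T + 2) * (m * m)) := by
  have hN' : (0 : ℝ) < N := by exact_mod_cast hN
  have hM' : (0 : ℝ) < M := by exact_mod_cast hM
  have hS' : (0 : ℝ) < S := by exact_mod_cast hS
  set r := Real.sqrt (N * (T + 2)) with hr
  have hr0 : 0 < r := Real.sqrt_pos.2 (by positivity)
  have hr2 : r * r = N * (T + 2) := Real.mul_self_sqrt (by positivity)
  have h1 : (S * N : ℝ) / M ≤ K := Nat.ceil_le.1 hK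
  have h2 : (M : ℝ) / (S * r) ≤ m := Nat.ceil_le.1 hm
  have h3 : (N : ℝ) / r ≤ K * m := by
    calc (N : ℝ) / r = (S * N : ℝ) / M * ((M : ℝ) / (S * r)) := by field_simp
      _ ≤ K * m := mul_le_mul h1 h2 (by positivity) (by positivity)
  have h4 : (N : ℝ) ≤ K * (K * (T + 2) * (m * m)) := by
    calc (N : ℝ) = N / r * (N / r) * (T + 2) := by
          field_simp
          rw [sq, hr2]
      _ ≤ (K * m) * (K * m) * (T + 2) := by gcongr
      _ = _ := by ring
  exact_mod_cast h4

theorem rep_dense_vector (N M : ℕ) (hN : 1 ≤ N) (hNM : N ≤ M)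
    (x : Fin N → ℤ) (hx : ∑ n, |x n| ≤ (M : ℤ))
    (S T : ℕ) (hS : 1 ≤ S) (hT : 1 ≤ T) :
    ∃ g ∈ NN 1 1
        (22 * max ⌈(M : ℝ) / (S * Real.sqrt (N * (T + 2)))⌉₊
                  ⌈((M : ℝ) / N) ^ ((T : ℝ)⁻¹)⌉₊ + 12)
        (4 * ⌈(S * N : ℝ) / M⌉₊ * (T + 2)),
      ∀ n : Fin N, g (fun _ => (n : ℝ) + 1) 0 = x n := by
  set m := max ⌈(M : ℝ) / (S * Real.sqrt (N * (T + 2)))⌉₊ ⌈((M : ℝ) / N) ^ ((T : ℝ)⁻¹)⌉₊ with hm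
  set K := ⌈(S * N : ℝ) / M⌉₊ with hK
  have hM : 1 ≤ M := hN.trans hNM
  have hN' : (0 : ℝ) < N := by exact_mod_cast hN
  have hM' : (0 : ℝ) < M := by exact_mod_cast hM
  have hS' : (0 : ℝ) < S := by exact_mod_cast hS
  have hm1 : 1 ≤ m := le_max_of_le_right (Nat.ceil_pos.2 (by positivity))
  have hK1 : 1 ≤ K := Nat.ceil_pos.2 (by positivity)
  have hMB : M ≤ N * m ^ T := le_mul_pow_of_ceil_rpow_le hN hT (le_max_right _ _)
  have hNK : N ≤ K * (K * (T + 2) * (m * m)) := le_mul_of_ceil_le hN hM hS le_rfl (le_max_left _ _)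
  let xs : ℕ → ℤ := fun n => if h : n < N then x ⟨n, h⟩ else 0
  let A : ℕ → ℕ := fun n => ∑ i ∈ Finset.range n, ((xs i).natAbs / m ^ T + 1)
  have hxs : ∀ n : Fin N, xs n = x n := fun n => by simp [xs]
  have hsum : ∑ n ∈ Finset.range N, (xs n).natAbs ≤ M := by
    rw [Finset.sum_range]
    zify
    simpa [hxs] using hx
  have hA1 : ∀ n, A (n + 1) = A n + ((xs n).natAbs / m ^ T + 1) := fun n =>
    Finset.sum_range_succ _ _
  have hAN : A N ≤ 2 * N := sum_range_pieces_le (by positivity) hMB hsum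
  have hreach := reach_of_pieces (N := N) (A := A) (D := K * (T + 2)) hm1 hT hK1 (xs := xs)
    (strictMono_nat_of_lt_succ fun n => by rw [hA1]; exact Nat.lt_add_of_pos_right (Nat.succ_pos _)) (by simp [A])
    (fun n => by
      rw [hA1, Nat.add_sub_cancel_left]
      exact (Nat.lt_mul_div_succ _ (by positivity)).le)
    (by
      refine Nat.div_le_of_le_mul (hAN.trans ?_)
      rw [mul_assoc 2 K]
      exact Nat.mul_le_mul_left 2 hNK)
  have hdepth : 2 * (K * (T + 2)) + 1 + (T + 1) + (2 * K - 1) * (T + 2) = 4 * K * (T + 2) := by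
    obtain ⟨k, hk⟩ : ∃ k, K = k + 1 := ⟨K - 1, by omega⟩
    rw [hk, show 2 * (k + 1) - 1 = 2 * k + 1 by omega]
    ring
  rw [hdepth] at hreach
  obtain ⟨g, hg, hgx⟩ := hreach 1 (fun _ n => (xs n : ℝ)) fun _ => subset_affSpan rfl
  exact ⟨g, hg, fun n => by rw [hgx n 0, hxs]⟩
end

section
/- (Encoding of S_{N,M} by deep ReLU networks) There exists an absolute constant C > 0 such that for all N, M ∈ ℕ with N, M ≥ 1 there exist W, L ∈ ℕ with W, L ≥ 1 satisfying W²L² ≤ C·M·(1 + log₂(N/M)) if N ≥ M and W²L² ≤ C·N·(1 + log₂(M/N)) if N ≤ M, such that for every x ∈ ℤ^N with Σ_{n=1}^N |x_n| ≤ M there exists g ∈ NN_{1,1}(W, L) with g(n) = x_n for all n = 1,…,N. -/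
open MeasureTheory ENNReal Finset

/-! ### Affine maps and composition of networks -/

/-- `f` is an affine functional on `ℝ^n`. -/
def IsAffineFunctional {n : ℕ} (f : (Fin n → ℝ) → ℝ) : Prop :=
  ∃ (m : Fin n → ℝ) (c : ℝ), ∀ x, f x = (∑ j, m j * x j) + c

namespace IsAffineFunctional

variable {n : ℕ} {f g : (Fin n → ℝ) → ℝ}

theorem const (c : ℝ) : IsAffineFunctional (fun _ : Fin n → ℝ => c) :=
  ⟨0, c, by simp⟩

theorem coord (i : Fin n) : IsAffineFunctional (fun x : Fin n → ℝ => x i) :=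
  ⟨Pi.single i 1, 0, by simp [Pi.single_apply]⟩

theorem add (hf : IsAffineFunctional f) (hg : IsAffineFunctional g) :
    IsAffineFunctional (fun x => f x + g x) := by
  obtain ⟨m, c, h⟩ := hf
  obtain ⟨m', c', h'⟩ := hg
  refine ⟨m + m', c + c', fun x => ?_⟩
  simp only [h, h', Pi.add_apply, add_mul, Finset.sum_add_distrib]
  ring

theorem const_mul (a : ℝ) (hf : IsAffineFunctional f) :
    IsAffineFunctional (fun x => a * f x) := by
  obtain ⟨m, c, h⟩ := hf
  refine ⟨fun j => a * m j, a * c, fun x => ?_⟩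
  simp only [h, mul_add, Finset.mul_sum, mul_assoc]

theorem sub (hf : IsAffineFunctional f) (hg : IsAffineFunctional g) :
    IsAffineFunctional (fun x => f x - g x) := by
  have h := hf.add (hg.const_mul (-1))
  simpa only [neg_one_mul, ← sub_eq_add_neg] using h

theorem sum {ι : Type*} (s : Finset ι) {f : ι → (Fin n → ℝ) → ℝ}
    (hf : ∀ i ∈ s, IsAffineFunctional (f i)) :
    IsAffineFunctional (fun x => ∑ i ∈ s, f i x) := by
  classical
  induction s using Finset.induction_on with
  | empty => simpa using const 0
  | insert a s ha ih =>
    simp only [Finset.sum_insert ha]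
    exact (hf a (by simp)).add (ih fun i hi => hf i (by simp [hi]))

theorem comp {m : ℕ} {A : (Fin m → ℝ) → (Fin n → ℝ)} (hf : IsAffineFunctional f)
    (hA : ∀ i, IsAffineFunctional (fun x => A x i)) :
    IsAffineFunctional (fun x => f (A x)) := by
  obtain ⟨w, c, h⟩ := hf
  simp only [h]
  exact (sum _ fun j _ => (hA j).const_mul (w j)).add (const c)

end IsAffineFunctional

theorem isAffineMap_iff {n m : ℕ} {A : (Fin n → ℝ) → (Fin m → ℝ)} :
    IsAffineMap A ↔ ∀ i, IsAffineFunctional (fun x => A x i) := by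
  constructor
  · rintro ⟨M, c, h⟩ i
    exact ⟨M i, c i, fun x => h x i⟩
  · intro h
    choose M c h using h
    exact ⟨M, c, fun x i => h i x⟩

theorem IsAffineMap.comp {n m k : ℕ} {B : (Fin m → ℝ) → (Fin k → ℝ)}
    {A : (Fin n → ℝ) → (Fin m → ℝ)} (hB : IsAffineMap B) (hA : IsAffineMap A) :
    IsAffineMap (fun x => B (A x)) := by
  rw [isAffineMap_iff] at *
  exact fun i => (hB i).comp hA

theorem NNaux_comp_affine {k W L m d : ℕ} {g : (Fin m → ℝ) → (Fin k → ℝ)}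
    {A : (Fin d → ℝ) → (Fin m → ℝ)} (hg : g ∈ NNaux k W L m) (hA : IsAffineMap A) :
    (fun x => g (A x)) ∈ NNaux k W L d := by
  cases L with
  | zero => exact IsAffineMap.comp hg hA
  | succ L =>
    obtain ⟨N, h1, h2, B, h, hB, hh, rfl⟩ := hg
    exact ⟨N, h1, h2, fun x => B (A x), h, hB.comp hA, hh, rfl⟩

theorem NN_comp {d m k W L₁ L₂ : ℕ} {f : (Fin d → ℝ) → (Fin m → ℝ)}
    {g : (Fin m → ℝ) → (Fin k → ℝ)} (hf : f ∈ NN d m W L₁) (hg : g ∈ NN m k W L₂) :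
    (fun x => g (f x)) ∈ NN d k W (L₁ + L₂) := by
  unfold NN at *
  induction L₁ generalizing d with
  | zero => simpa using NNaux_comp_affine hg hf
  | succ L ih =>
    obtain ⟨N, h1, h2, A, h, hA, hh, rfl⟩ := hf
    rw [Nat.add_right_comm]
    exact ⟨N, h1, h2, A, fun x => g (h x), hA, ih hh, rfl⟩

theorem relu_sub_relu_neg (t : ℝ) : relu t - relu (-t) = t := by
  unfold relu
  rcases le_total t 0 with h | h
  · rw [max_eq_right h, max_eq_left (by linarith)]; ring
  · rw [max_eq_left h, max_eq_right (by linarith)]; ring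

/-- An affine map plus two rank-one ReLU terms is a network with one hidden layer. -/
theorem residual_mem_NN {d k W : ℕ} (hW : d + d + 2 ≤ W) {A : (Fin d → ℝ) → (Fin k → ℝ)}
    (hA : IsAffineMap A) {l₁ l₂ : (Fin d → ℝ) → ℝ} (h₁ : IsAffineFunctional l₁)
    (h₂ : IsAffineFunctional l₂) (w₁ w₂ : Fin k → ℝ) :
    (fun x i => A x i + (w₁ i * relu (l₁ x) + w₂ i * relu (l₂ x))) ∈ NN d k W 1 := by
  refine ⟨d + d + 2, by omega, hW,
    fun x => Fin.append (Fin.append x (fun j => -x j)) ![l₁ x, l₂ x],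
    fun z i => A (fun j => z (Fin.castAdd 2 (Fin.castAdd d j)) - z (Fin.castAdd 2 (Fin.natAdd d j))) i
      + (w₁ i * z (Fin.natAdd (d + d) 0) + w₂ i * z (Fin.natAdd (d + d) 1)), ?_, ?_, ?_⟩
  · rw [isAffineMap_iff]
    intro i
    refine Fin.addCases (fun i => ?_) (fun i => ?_) i
    · refine Fin.addCases (fun i => ?_) (fun i => ?_) i
      · simpa using IsAffineFunctional.coord i
      · simpa only [Fin.append_left, Fin.append_right, neg_one_mul] using
          (IsAffineFunctional.coord i).const_mul (-1)
    · simp only [Fin.append_right]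
      fin_cases i
      · simpa using h₁
      · simpa using h₂
  · change IsAffineMap _
    rw [isAffineMap_iff] at hA ⊢
    intro i
    refine IsAffineFunctional.add ((hA i).comp fun j => ?_) (.add (.const_mul _ (.coord _)) (.const_mul _ (.coord _)))
    exact .sub (.coord _) (.coord _)
  · funext x i
    simp only [Fin.append_left, Fin.append_right, relu_sub_relu_neg]
    simp

/-! ### Networks acting on integer states -/

/-- The map `F` on integer states is computed by a network of width 14 with `L` hidden layers. -/
def Computes (L : ℕ) (F : (Fin 6 → ℤ) → (Fin 6 → ℤ)) : Prop :=
  ∃ g ∈ NN 6 6 14 L, ∀ S : Fin 6 → ℤ, g (fun i => (S i : ℝ)) = fun i => (F S i : ℝ)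

theorem computes_id : Computes 0 id := by
  refine ⟨id, ?_, fun S => rfl⟩
  change IsAffineMap _
  rw [isAffineMap_iff]
  exact fun i => .coord i

theorem Computes.comp {L₁ L₂ : ℕ} {F G : (Fin 6 → ℤ) → (Fin 6 → ℤ)} (hF : Computes L₁ F)
    (hG : Computes L₂ G) : Computes (L₁ + L₂) (fun S => G (F S)) := by
  obtain ⟨f, hf, hf'⟩ := hF
  obtain ⟨g, hg, hg'⟩ := hG
  exact ⟨_, NN_comp hf hg, fun S => by rw [hf', hg']⟩

/-- Adding `w` to the state whenever coordinate `a` is at least `θ`. -/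
def thresholdStep (a : Fin 6) (θ : ℤ) (w : Fin 6 → ℤ) (S : Fin 6 → ℤ) : Fin 6 → ℤ :=
  fun i => S i + if θ ≤ S a then w i else 0

theorem computes_thresholdStep (a : Fin 6) (θ : ℤ) (w : Fin 6 → ℤ) :
    Computes 1 (thresholdStep a θ w) := by
  refine ⟨_, residual_mem_NN le_rfl (A := fun x => x) ?_
    (l₁ := fun x => x a + ((1 : ℝ) - θ)) (l₂ := fun x => x a - θ)
    (.add (.coord a) (.const _)) (.sub (.coord a) (.const _)) (fun i => w i) (fun i => -w i), ?_⟩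
  · rw [isAffineMap_iff]
    exact fun i => .coord i
  · intro S
    funext i
    simp only [thresholdStep, relu]
    split_ifs with h
    · have h' : (θ : ℝ) ≤ S a := by exact_mod_cast h
      rw [max_eq_left (by linarith), max_eq_left (by linarith)]
      push_cast
      ring
    · have h' : (S a : ℝ) + 1 ≤ θ := by exact_mod_cast (not_le.mp h)
      rw [max_eq_right (by linarith), max_eq_right (by linarith)]
      simp

/-- Gated accumulation: for a flag `S 4 ∈ {0, 1}` and a value `0 ≤ S 3 ≤ B`, add
`S 4 * (S 3 - Q)` to the output register and clear the value and the flag. -/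
def gateStep (B Q : ℤ) (S : Fin 6 → ℤ) : Fin 6 → ℤ :=
  ![S 0, S 1, S 2, 0, 0, S 5 - Q * S 4 + max (S 3 + B * S 4 - B) 0]

theorem computes_gateStep (B Q : ℤ) : Computes 1 (gateStep B Q) := by
  refine ⟨_, residual_mem_NN le_rfl
    (A := fun x => ![x 0, x 1, x 2, 0, 0, x 5 - Q * x 4]) ?_
    (l₁ := fun x => x 3 + B * x 4 - B) (l₂ := fun _ => 0)
    (.sub (.add (.coord 3) (.const_mul _ (.coord 4))) (.const _)) (.const 0)
    ![0, 0, 0, 0, 0, 1] 0, ?_⟩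
  · rw [isAffineMap_iff]
    intro i
    fin_cases i
    · exact .coord 0
    · exact .coord 1
    · exact .coord 2
    · exact .const 0
    · exact .const 0
    · exact .sub (.coord 5) (.const_mul _ (.coord 4))
  · intro S
    funext i
    fin_cases i <;> simp [gateStep, relu]

/-! ### Decoding a list of tokens -/

/-- Reading the leading `e`-bit digit `q` of register `1` and adding `q • w` to the state. -/
theorem exists_readDigit (k e : ℕ) (w : Fin 6 → ℤ) (hw : w 1 = -2 ^ k) :
    ∃ F, Computes e F ∧ ∀ (S : Fin 6 → ℤ) (q r : ℕ), q < 2 ^ e → r < 2 ^ k →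
      S 1 = q * 2 ^ k + r → F S = fun i => S i + q * w i := by
  induction e with
  | zero =>
    refine ⟨id, computes_id, fun S q r hq _ _ => ?_⟩
    obtain rfl : q = 0 := by simpa using hq
    simp
  | succ e ih =>
    obtain ⟨F, hF, hF'⟩ := ih
    refine ⟨fun S => F (thresholdStep 1 (2 ^ (k + e)) (fun i => 2 ^ e * w i) S), ?_, ?_⟩
    · rw [add_comm]
      exact (computes_thresholdStep _ _ _).comp hF
    intro S q r hq hr hS
    beta_reduce
    by_cases h : 2 ^ e ≤ q
    · obtain ⟨q', rfl⟩ := Nat.exists_eq_add_of_le h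
      have hθ : (2 : ℤ) ^ (k + e) ≤ S 1 := by
        rw [hS, pow_add]
        push_cast
        have h1 : (0 : ℤ) ≤ q' * 2 ^ k := by positivity
        linarith [mul_comm ((2 : ℤ) ^ k) (2 ^ e), Int.natCast_nonneg r]
      rw [hF' _ q' r (by rw [pow_succ] at hq; omega) hr]
      · funext i
        simp only [thresholdStep, if_pos hθ]
        push_cast
        ring
      · simp only [thresholdStep, if_pos hθ]
        rw [hS, hw]
        push_cast
        ring
    · have hθ : ¬ (2 : ℤ) ^ (k + e) ≤ S 1 := by
        have h1 : q * 2 ^ k + r < 2 ^ (k + e) := by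
          have : (q + 1) * 2 ^ k ≤ 2 ^ e * 2 ^ k := Nat.mul_le_mul_right _ (by omega)
          rw [pow_add, mul_comm (2 ^ k)]
          linarith
        rw [hS, not_le]
        exact_mod_cast h1
      rw [hF' _ q r (by omega) hr]
      · funext i
        simp [thresholdStep, if_neg hθ]
      · simpa only [thresholdStep, if_neg hθ, add_zero] using hS

/-- The integer whose base-`2 ^ e` digits are the entries of the tokens. -/
def tokenCode (e : ℕ) : List (ℕ × ℕ) → ℕ
  | [] => 0
  | (d, v) :: l => d * 2 ^ (2 * e * l.length + e) + (v * 2 ^ (2 * e * l.length) + tokenCode e l)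

/-- The value at position `p` described by a token list: the token `(d, v)` moves forward by `d`
positions and then adds `v - Q` to the entry there. -/
def tokenValue (Q : ℕ) : List (ℕ × ℕ) → ℤ → ℤ
  | [], _ => 0
  | (d, v) :: l, p => (if p - d = 0 then (v : ℤ) - Q else 0) + tokenValue Q l (p - d)

/-- All entries of the tokens are `e`-bit numbers. -/
def TokensBounded (e : ℕ) (l : List (ℕ × ℕ)) : Prop :=
  ∀ t ∈ l, t.1 < 2 ^ e ∧ t.2 < 2 ^ e

theorem digit_append_lt {a r m n : ℕ} (ha : a < 2 ^ m) (hr : r < 2 ^ n) :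
    a * 2 ^ n + r < 2 ^ (n + m) := by
  have : (a + 1) * 2 ^ n ≤ 2 ^ m * 2 ^ n := Nat.mul_le_mul_right _ (by omega)
  rw [pow_add, mul_comm (2 ^ n)]
  linarith

theorem tokenCode_lt {e : ℕ} {l : List (ℕ × ℕ)} (hl : TokensBounded e l) :
    tokenCode e l < 2 ^ (2 * e * l.length) := by
  induction l with
  | nil => simp [tokenCode]
  | cons t l ih =>
    obtain ⟨d, v⟩ := t
    have ht := hl (d, v) (by simp)
    have h := digit_append_lt ht.1 (digit_append_lt ht.2 (ih fun s hs => hl s (by simp [hs])))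
    rw [show 2 * e * (((d, v) :: l).length) = 2 * e * l.length + e + e by
      rw [List.length_cons]; ring]
    exact h

theorem tokenValue_of_neg (Q : ℕ) (l : List (ℕ × ℕ)) {p : ℤ} (hp : p < 0) :
    tokenValue Q l p = 0 := by
  induction l generalizing p with
  | nil => rfl
  | cons t l ih =>
    obtain ⟨d, v⟩ := t
    rw [tokenValue, if_neg (by omega), ih (by omega), add_zero]

/-- Processing the leading token of register `1`. -/
theorem exists_readToken (k e Q : ℕ) :
    ∃ F, Computes (2 * e + 3) F ∧ ∀ (S : Fin 6 → ℤ) (d v r : ℕ), d < 2 ^ e → v < 2 ^ e →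
      r < 2 ^ k → S 1 = ((d * 2 ^ (k + e) + (v * 2 ^ k + r) : ℕ) : ℤ) → S 3 = 0 → S 4 = 0 →
      F S = ![S 0, r, S 2 - d, 0, 0, S 5 + if S 2 - d = 0 then (v : ℤ) - Q else 0] := by
  obtain ⟨F₁, hF₁, h₁⟩ := exists_readDigit (k + e) e ![0, -2 ^ (k + e), -1, 0, 0, 0] rfl
  obtain ⟨F₂, hF₂, h₂⟩ := exists_readDigit k e ![0, -2 ^ k, 0, 1, 0, 0] rfl
  have hT := (computes_thresholdStep 2 0 ![0, 0, 0, 0, 1, 0]).comp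
    (computes_thresholdStep 2 1 ![0, 0, 0, 0, -1, 0])
  refine ⟨fun S => gateStep (2 ^ e) Q (thresholdStep 2 1 ![0, 0, 0, 0, -1, 0]
    (thresholdStep 2 0 ![0, 0, 0, 0, 1, 0] (F₂ (F₁ S)))), ?_, ?_⟩
  · have h := ((hF₁.comp hF₂).comp hT).comp (computes_gateStep (2 ^ e) Q)
    convert h using 1
    ring
  intro S d v r hd hv hr hS h3 h4
  have e1 : F₁ S = ![S 0, ((v * 2 ^ k + r : ℕ) : ℤ), S 2 - d, 0, 0, S 5] := by
    rw [h₁ S d (v * 2 ^ k + r) hd (digit_append_lt hv hr) (by rw [hS]; push_cast; ring)]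
    funext i
    fin_cases i <;> simp [hS, h3, h4]
    ring
  have e2 : F₂ (F₁ S) = ![S 0, r, S 2 - d, v, 0, S 5] := by
    rw [e1, h₂ _ v r hv hr (by simp)]
    funext i
    fin_cases i <;> simp
  have hv' : (v : ℤ) < 2 ^ e := by exact_mod_cast hv
  have hv0 : (0 : ℤ) ≤ v := Int.natCast_nonneg v
  have e3 : thresholdStep 2 1 ![0, 0, 0, 0, -1, 0] (thresholdStep 2 0 ![0, 0, 0, 0, 1, 0]
      (F₂ (F₁ S))) = ![S 0, r, S 2 - d, v, if S 2 - d = 0 then 1 else 0, S 5] := by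
    rw [e2]
    funext i
    fin_cases i <;> simp [thresholdStep]
    grind
  simp only [e3]
  funext i
  fin_cases i <;> simp [gateStep]
  split_ifs
  · rw [max_eq_left (by linarith)]; ring
  · rw [max_eq_right (by linarith)]; ring

theorem exists_tokenDecoder (e Q T : ℕ) :
    ∃ F, Computes ((2 * e + 3) * T) F ∧ ∀ l : List (ℕ × ℕ), l.length = T → TokensBounded e l →
      ∀ S : Fin 6 → ℤ, S 1 = (tokenCode e l : ℤ) → S 3 = 0 → S 4 = 0 →
        F S 5 = S 5 + tokenValue Q l (S 2) := by
  induction T with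
  | zero =>
    refine ⟨id, computes_id, fun l hl _ S _ _ _ => ?_⟩
    obtain rfl : l = [] := List.length_eq_zero_iff.mp hl
    simp [tokenValue]
  | succ T ih =>
    obtain ⟨F, hF, hF'⟩ := ih
    obtain ⟨G, hG, hG'⟩ := exists_readToken (2 * e * T) e Q
    refine ⟨_, by rw [mul_add_one, add_comm]; exact hG.comp hF, ?_⟩
    rintro (_ | ⟨⟨d, v⟩, l⟩) hl hb S h1 h3 h4
    · simp at hl
    obtain rfl : l.length = T := by simpa using hl
    have hb' : TokensBounded e l := fun t ht => hb t (by simp [ht])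
    have ht := hb (d, v) (by simp)
    rw [hG' S d v (tokenCode e l) ht.1 ht.2 (tokenCode_lt hb') h1 h3 h4,
      hF' l rfl hb' _ (by simp) (by simp) (by simp)]
    simp [tokenValue, add_assoc]

/-! ### Encoding by tokens -/

/-- The number of tokens needed for an entry of value `z`. -/
def entryCost (Q : ℕ) (z : ℤ) : ℕ := z.natAbs / Q + if z = 0 then 0 else 1

/-- Clipping a nonzero integer to `[-Q, Q]` leaves a remainder which is cheaper by one. -/
theorem exists_clip {Q : ℕ} (hQ : 1 ≤ Q) {z : ℤ} (hz : z ≠ 0) :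
    ∃ v : ℕ, v ≤ 2 * Q ∧ entryCost Q (z - ((v : ℤ) - Q)) + 1 ≤ entryCost Q z := by
  unfold entryCost
  by_cases h : z.natAbs < Q
  · refine ⟨(z + Q).toNat, by omega, ?_⟩
    rw [show z - (((z + Q).toNat : ℤ) - Q) = 0 by omega]
    simp [hz]
  · obtain ⟨v, hv, hv'⟩ : ∃ v : ℕ, v ≤ 2 * Q ∧ (z - ((v : ℤ) - Q)).natAbs = z.natAbs - Q := by
      rcases lt_or_gt_of_ne hz with h0 | h0
      · exact ⟨0, by omega, by omega⟩
      · exact ⟨2 * Q, le_rfl, by omega⟩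
    refine ⟨v, hv, ?_⟩
    have h1 : z.natAbs / Q = (z.natAbs - Q) / Q + 1 :=
      Nat.div_eq_sub_div (by omega) (by omega)
    rw [hv', if_neg hz, h1]
    split_ifs <;> omega

theorem exists_tokens {Q e : ℕ} (hQ : 1 ≤ Q) (he : 2 * Q < 2 ^ e) (c : ℕ) (f : ℕ → ℤ) (n : ℕ)
    (hc : ∑ m ∈ range n, entryCost Q (f m) + n / Q ≤ c) :
    ∃ l : List (ℕ × ℕ), l.length = c ∧ TokensBounded e l ∧
      ∀ i : ℕ, i < n → tokenValue Q l i = f i := by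
  induction c generalizing f n with
  | zero =>
    refine ⟨[], rfl, by simp [TokensBounded], fun i hi => ?_⟩
    have h0 := (Nat.add_eq_zero_iff.mp (Nat.le_zero.mp hc)).1
    have h1 := Finset.sum_eq_zero_iff.mp h0 i (by simpa using hi)
    by_contra h
    rw [entryCost, if_neg fun h' => h (by rw [h', tokenValue])] at h1
    exact Nat.succ_ne_zero _ h1
  | succ c ih =>
    by_cases hex : ∃ m, m < n ∧ m < Q ∧ f m ≠ 0
    · classical
      obtain ⟨hmn, hmQ, hm0⟩ := Nat.find_spec hex
      have hmin : ∀ i, i < Nat.find hex → f i = 0 := fun i hi => by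
        by_contra h
        exact Nat.find_min hex hi ⟨by omega, by omega, h⟩
      generalize Nat.find hex = m at *
      obtain ⟨n, rfl⟩ := Nat.exists_eq_add_of_lt hmn
      obtain ⟨v, hv, hcost⟩ := exists_clip hQ hm0
      obtain ⟨l, hl, hb, hval⟩ := ih
        (fun i => if i = 0 then f m - ((v : ℤ) - Q) else f (m + i)) (n + 1) (by
          have h1 : (n + 1) / Q ≤ (m + n + 1) / Q := Nat.div_le_div_right (by omega)
          rw [add_assoc m, Finset.sum_range_add, Finset.sum_range_succ' _ n] at hc
          rw [Finset.sum_range_succ']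
          simp only [Nat.add_eq_zero_iff, one_ne_zero, and_false, if_false, if_true, add_zero] at *
          rw [add_assoc m] at h1
          omega)
      refine ⟨(m, v) :: l, by simp [hl], ?_, fun i hi => ?_⟩
      · intro t ht
        rcases List.mem_cons.mp ht with rfl | ht
        · exact ⟨by simp only; omega, by simp only; omega⟩
        · exact hb t ht
      · rw [tokenValue]
        by_cases him : i < m
        · rw [if_neg (by omega), tokenValue_of_neg _ _ (by omega), hmin i him, add_zero]
        · obtain ⟨j, rfl⟩ := Nat.exists_eq_add_of_le (not_lt.mp him)
          rw [show ((m + j : ℕ) : ℤ) - m = (j : ℕ) by push_cast; ring, hval j (by omega)]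
          rcases Nat.eq_zero_or_pos j with rfl | hj
          · simp
          · rw [if_neg (by omega), if_neg (by omega), zero_add]
    · push Not at hex
      obtain ⟨l, hl, hb, hval⟩ := ih (fun i => f (Q + i)) (n - Q) (by
        rcases lt_or_ge n Q with h | h
        · simp [Nat.sub_eq_zero_of_le h.le]
        · obtain ⟨n, rfl⟩ := Nat.exists_eq_add_of_le h
          rw [Finset.sum_range_add, Nat.add_div_left _ (by omega)] at hc
          simp only [Nat.add_sub_cancel_left]
          omega)
      refine ⟨(Q, Q) :: l, by simp [hl], ?_, fun i hi => ?_⟩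
      · intro t ht
        rcases List.mem_cons.mp ht with rfl | ht
        · exact ⟨by simp only; omega, by simp only; omega⟩
        · exact hb t ht
      · rw [tokenValue, sub_self, ite_self, zero_add]
        by_cases hiQ : i < Q
        · rw [tokenValue_of_neg _ _ (by omega), hex i hi hiQ]
        · obtain ⟨j, rfl⟩ := Nat.exists_eq_add_of_le (not_lt.mp hiQ)
          rw [show ((Q + j : ℕ) : ℤ) - Q = (j : ℕ) by push_cast; ring, hval j (by omega)]

/-! ### Grouping indices -/

/-- The cost of encoding the entries of index less than `n`. -/
def prefixCost (Q : ℕ) (y : ℕ → ℤ) (n : ℕ) : ℕ :=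
  ∑ m ∈ range n, entryCost Q (y m) + n / Q

theorem prefixCost_mono (Q : ℕ) (y : ℕ → ℤ) : Monotone (prefixCost Q y) := fun _ _ h =>
  add_le_add (Finset.sum_le_sum_of_subset (Finset.range_mono h)) (Nat.div_le_div_right h)

/-- Indices with the same key form a group which is cheap to encode or consists of one index. -/
def groupKey (Q T : ℕ) (y : ℕ → ℤ) (n : ℕ) : ℕ :=
  prefixCost Q y n / T + prefixCost Q y (n + 1) / T

theorem groupKey_mono (Q T : ℕ) (y : ℕ → ℤ) : Monotone (groupKey Q T y) := fun _ _ h =>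
  add_le_add (Nat.div_le_div_right (prefixCost_mono Q y h))
    (Nat.div_le_div_right (prefixCost_mono Q y (by omega)))

theorem sub_le_of_div_eq {a b T : ℕ} (hT : 1 ≤ T) (h : a / T = b / T) : b ≤ a + (T - 1) := by
  have h1 := Nat.div_add_mod a T
  have h2 := Nat.div_add_mod b T
  have h3 := Nat.mod_lt b (show T > 0 by omega)
  rw [h] at h1
  omega

theorem prefixCost_le_of_groupKey_eq {Q T : ℕ} (hT : 1 ≤ T) {y : ℕ → ℤ} {a b : ℕ} (hab : a < b)
    (h : groupKey Q T y a = groupKey Q T y b) :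
    prefixCost Q y (b + 1) ≤ prefixCost Q y a + 2 * (T - 1) := by
  unfold groupKey at h
  have h1 := Nat.div_le_div_right (c := T) (prefixCost_mono Q y hab.le)
  have h2 := Nat.div_le_div_right (c := T) (prefixCost_mono Q y (Nat.succ_le_succ hab.le))
  have h3 := sub_le_of_div_eq hT (a := prefixCost Q y a) (b := prefixCost Q y b) (by
    simp only [Nat.succ_eq_add_one] at h2
    omega)
  have h4 := sub_le_of_div_eq hT (a := prefixCost Q y (a + 1)) (b := prefixCost Q y (b + 1)) (by
    simp only [Nat.succ_eq_add_one] at h2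
    omega)
  have h5 := prefixCost_mono Q y (Nat.succ_le_of_lt hab)
  simp only [Nat.succ_eq_add_one] at *
  omega

theorem exists_groupCode {Q e T : ℕ} (hQ : 2 ≤ Q) (he : 2 * Q < 2 ^ e) (hT : 1 ≤ T) (N : ℕ)
    (y : ℕ → ℤ) (j : ℕ) :
    ∃ (l : List (ℕ × ℕ)) (s : ℕ) (o : ℤ), l.length = 2 * (T - 1) ∧ TokensBounded e l ∧
      ∀ n, n < N → groupKey Q T y n = j → o + tokenValue Q l ((n : ℤ) - s) = y n := by
  classical
  by_cases hex : ∃ n, n < N ∧ groupKey Q T y n = j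
  · obtain ⟨haN, haj⟩ := Nat.find_spec hex
    have hmin : ∀ n, n < N → groupKey Q T y n = j → Nat.find hex ≤ n :=
      fun n h1 h2 => Nat.find_min' hex ⟨h1, h2⟩
    generalize Nat.find hex = a at *
    by_cases hex' : ∃ b, b < N ∧ groupKey Q T y b = j ∧ a < b
    · obtain ⟨b, hb⟩ : ∃ b, b < N ∧ groupKey Q T y b = j ∧ a < b ∧
          ∀ n, n < N → groupKey Q T y n = j → n ≤ b := by
        obtain ⟨b₀, h1, h2, h3⟩ := hex'
        have hne : ((range N).filter fun n => groupKey Q T y n = j).Nonempty := ⟨b₀, by simp [h1, h2]⟩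
        have hmem := Finset.max'_mem _ hne
        simp only [Finset.mem_filter, Finset.mem_range] at hmem
        have hle : ∀ n, n < N → groupKey Q T y n = j → n ≤ Finset.max' _ hne :=
          fun n h h' => Finset.le_max' _ n (by simp [h, h'])
        exact ⟨_, hmem.1, hmem.2, h3.trans_le (hle b₀ h1 h2), hle⟩
      obtain ⟨-, hbj, hab, hmax⟩ := hb
      have hcost := prefixCost_le_of_groupKey_eq (Q := Q) hT hab (haj.trans hbj.symm)
      obtain ⟨len, rfl⟩ := Nat.exists_eq_add_of_lt hab
      obtain ⟨l, hl, hlb, hval⟩ := exists_tokens (by omega) he (2 * (T - 1)) (fun i => y (a + i)) (len + 2) (by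
        unfold prefixCost at hcost
        rw [show a + len + 1 + 1 = a + (len + 2) by ring, Finset.sum_range_add] at hcost
        have := @Nat.div_add_div_le_add_div a (len + 2) Q
        omega)
      refine ⟨l, a, 0, hl, hlb, fun n hn hnj => ?_⟩
      obtain ⟨i, rfl⟩ := Nat.exists_eq_add_of_le (hmin n hn hnj)
      have := hmax _ hn hnj
      rw [show ((a + i : ℕ) : ℤ) - a = (i : ℕ) by push_cast; ring, hval i (by omega), zero_add]
    · push Not at hex'
      obtain ⟨l, hl, hlb, hval⟩ := exists_tokens (by omega) he (2 * (T - 1)) (fun _ => 0) 1 (by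
        simp [entryCost, Nat.div_eq_of_lt hQ])
      refine ⟨l, a, y a, hl, hlb, fun n hn hnj => ?_⟩
      obtain rfl : n = a := le_antisymm (hex' n hn hnj) (hmin n hn hnj)
      have := hval 0 (by omega)
      simp only [Nat.cast_zero] at this
      rw [sub_self, this, add_zero]
  · push Not at hex
    obtain ⟨l, hl, hlb, -⟩ := exists_tokens (by omega) he (2 * (T - 1)) (fun _ => 0) 0 (by simp)
    exact ⟨l, 0, 0, hl, hlb, fun n hn hnj => absurd hnj (hex n hn)⟩

/-! ### The encoding network -/

/-- Adding to the state the value `G j` selected by the number `j` of thresholds below `S 0`,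
relative to the value `G 0`. -/
theorem exists_selector (θ : ℕ → ℤ) (G : ℕ → Fin 6 → ℤ) (hG : ∀ r, G r 0 = 0) (R : ℕ) :
    ∃ F, Computes R F ∧ ∀ (S : Fin 6 → ℤ) (j : ℕ), j ≤ R → (∀ r < R, θ r ≤ S 0 ↔ r < j) →
      F S = fun i => S i + (G j i - G 0 i) := by
  induction R with
  | zero =>
    refine ⟨id, computes_id, fun S j hj _ => ?_⟩
    obtain rfl : j = 0 := by omega
    simp
  | succ R ih =>
    obtain ⟨F, hF, hF'⟩ := ih
    refine ⟨_, hF.comp (computes_thresholdStep 0 (θ R) fun i => G (R + 1) i - G R i), ?_⟩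
    intro S j hj hθ
    have hR := hθ R (by omega)
    rcases Nat.lt_or_ge R j with h | h
    · obtain rfl : j = R + 1 := by omega
      rw [hF' S R le_rfl fun r hr => (hθ r (by omega)).trans (by omega)]
      funext i
      simp only [thresholdStep, hG, sub_zero, add_zero, if_pos (hR.mpr h)]
      ring
    · rw [hF' S j h fun r hr => hθ r (by omega)]
      funext i
      simp [thresholdStep, hG, if_neg (mt hR.mp (not_lt.mpr h))]

theorem exists_threshold_s13 {κ : ℕ → ℕ} (hκ : Monotone κ) (N r : ℕ) :
    ∃ θ : ℤ, ∀ n < N, θ ≤ (n : ℤ) ↔ r < κ n := by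
  classical
  by_cases h : ∃ n, r < κ n
  · refine ⟨Nat.find h, fun n _ => ?_⟩
    rw [Nat.cast_le]
    exact ⟨fun h' => (Nat.find_spec h).trans_le (hκ h'), fun h' => Nat.find_min' h h'⟩
  · push Not at h
    exact ⟨N, fun n hn => by have := h n; omega⟩

theorem exists_encoding_network {Q e T R N : ℕ} (hQ : 2 ≤ Q) (he : 2 * Q < 2 ^ e) (hT : 1 ≤ T)
    (y : ℕ → ℤ) (hR : ∀ n < N, groupKey Q T y n ≤ R) :
    ∃ g ∈ NN 1 1 14 (R + (2 * e + 3) * (2 * (T - 1))),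
      ∀ n : ℕ, n < N → g (fun _ => (n : ℝ) + 1) 0 = y n := by
  choose l s o hl hb hval using exists_groupCode hQ he hT N y
  choose θ hθ using exists_threshold_s13 (groupKey_mono Q T y) N
  obtain ⟨F, ⟨f, hf, hf'⟩, hF⟩ := exists_selector θ
    (fun j => ![0, (tokenCode e (l j) : ℤ), -(s j : ℤ), 0, 0, o j]) (fun _ => rfl) R
  obtain ⟨D, ⟨d, hd, hd'⟩, hD⟩ := exists_tokenDecoder e Q (2 * (T - 1))
  have hA : (fun (t : Fin 1 → ℝ) => ![t 0 - 1, (tokenCode e (l 0) : ℝ), t 0 - 1 - s 0, 0, 0,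
      (o 0 : ℝ)]) ∈ NN 1 6 14 0 := by
    change IsAffineMap _
    rw [isAffineMap_iff]
    intro i
    fin_cases i
    · exact .sub (.coord 0) (.const 1)
    · exact .const _
    · exact .sub (.sub (.coord 0) (.const 1)) (.const _)
    · exact .const 0
    · exact .const 0
    · exact .const _
  have hP : (fun (S : Fin 6 → ℝ) (_ : Fin 1) => S 5) ∈ NN 6 1 14 0 := by
    change IsAffineMap _
    rw [isAffineMap_iff]
    exact fun _ => .coord 5
  refine ⟨_, by simpa only [zero_add, add_zero] using NN_comp (NN_comp (NN_comp hA hf) hd) hP, ?_⟩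
  intro n hn
  have hS : ![(n : ℝ) + 1 - 1, (tokenCode e (l 0) : ℝ), (n : ℝ) + 1 - 1 - s 0, 0, 0, (o 0 : ℝ)] =
      fun i => ((![(n : ℤ), (tokenCode e (l 0) : ℤ), (n : ℤ) - s 0, 0, 0, o 0] : Fin 6 → ℤ) i : ℝ) := by
    funext i
    fin_cases i <;> simp
  set j := groupKey Q T y n with hj
  simp only [hS, hf', hd']
  rw [hF _ j (hR n hn) fun r _ => hθ r n hn,
    hD (l j) (hl j) (hb j) _ (by simp) (by simp) (by simp), ← hval j n hn hj.symm]
  simp [← sub_eq_add_neg]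

/-! ### Counting layers -/

theorem prefixCost_le {Q K N M : ℕ} (hN : N ≤ K * Q) (hM : M ≤ K * Q) (hK : min N M ≤ K)
    {y : ℕ → ℤ} (hy : ∑ m ∈ range N, (y m).natAbs ≤ M) : prefixCost Q y N ≤ 3 * K := by
  have h1 : ∑ m ∈ range N, (y m).natAbs / Q ≤ K := by
    rcases Nat.eq_zero_or_pos Q with rfl | hQ
    · simp
    · refine Nat.le_of_mul_le_mul_right ?_ hQ
      rw [Finset.sum_mul]
      exact ((Finset.sum_le_sum fun m _ => Nat.div_mul_le_self _ _).trans hy).trans hM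
  have h2 : ∑ m ∈ range N, (if y m = 0 then 0 else 1) ≤ N := by
    refine (Finset.sum_le_card_nsmul _ _ 1 fun m _ => by split_ifs <;> simp).trans (by simp)
  have h3 : ∑ m ∈ range N, (if y m = 0 then 0 else 1) ≤ M :=
    (Finset.sum_le_sum fun m _ => by split_ifs <;> omega).trans hy
  have h4 : N / Q ≤ K := Nat.div_le_of_le_mul (by rw [mul_comm]; exact hN)
  unfold prefixCost entryCost
  rw [Finset.sum_add_distrib]
  have h5 := le_min h2 h3
  omega

/-- The group size balancing the number of groups against the cost of decoding a group. -/
theorem exists_groupSize {K b : ℕ} (hK : 1 ≤ K) (hb : 1 ≤ b) :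
    ∃ T, 1 ≤ T ∧ (2 * (3 * K / T) + 1 + (2 * (b + 2) + 3) * (2 * (T - 1))) ^ 2 ≤
      4489 * (K * b) := by
  set s := Nat.sqrt (K * b) with hs
  have hs1 : s * s ≤ K * b := Nat.sqrt_le _
  have hs2 : K * b < (s + 1) * (s + 1) := Nat.lt_succ_sqrt _
  have hpos : 1 ≤ K * b := Nat.mul_pos hK hb
  have hspos : 1 ≤ s := Nat.sqrt_pos.mpr hpos
  suffices h : ∃ T, 1 ≤ T ∧ 2 * (3 * K / T) + 1 + (2 * (b + 2) + 3) * (2 * (T - 1)) ≤ 67 * s by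
    obtain ⟨T, hT, h⟩ := h
    refine ⟨T, hT, (Nat.pow_le_pow_left h 2).trans ?_⟩
    nlinarith
  rcases Nat.lt_or_ge s b with h | h
  · refine ⟨1, le_rfl, ?_⟩
    have hKs : K ≤ s := by
      by_contra hc
      nlinarith
    simp
    omega
  · have hT : 1 ≤ s / b := (Nat.one_le_div_iff (by omega)).mpr h
    have hTb : s / b * b ≤ s := Nat.div_mul_le_self _ _
    have hsT : s < (s / b + 1) * b := by
      rw [mul_comm]
      exact Nat.lt_mul_div_succ s (by omega)
    generalize s / b = T at *
    refine ⟨T, hT, ?_⟩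
    have h1 : K ≤ 8 * s * T := by
      have h2 : s ≤ 2 * T * b := by nlinarith
      have h3 : K * b ≤ 8 * s * T * b := by nlinarith
      exact Nat.le_of_mul_le_mul_right h3 (by omega)
    have h2 : 3 * K / T ≤ 24 * s := Nat.div_le_of_le_mul (by nlinarith)
    have h3 : (2 * (b + 2) + 3) * (2 * (T - 1)) ≤ 18 * s := by
      obtain ⟨T, rfl⟩ := Nat.exists_eq_add_of_le' hT
      simp only [Nat.add_sub_cancel]
      nlinarith
    omega

theorem exists_depth {N M K b : ℕ} (hK : 1 ≤ K) (hb : 1 ≤ b) (hN : N ≤ K * 2 ^ b)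
    (hM : M ≤ K * 2 ^ b) (hNM : min N M ≤ K) :
    ∃ L, 1 ≤ L ∧ L ^ 2 ≤ 4489 * (K * b) ∧ ∀ x : Fin N → ℤ, ∑ n, |x n| ≤ (M : ℤ) →
      ∃ g ∈ NN 1 1 14 L, ∀ n : Fin N, g (fun _ => (n : ℝ) + 1) 0 = x n := by
  obtain ⟨T, hT, hL⟩ := exists_groupSize hK hb
  refine ⟨_, by omega, hL, fun x hx => ?_⟩
  set y : ℕ → ℤ := fun n => if h : n < N then x ⟨n, h⟩ else 0 with hy
  have hyx : ∀ n : Fin N, y n = x n := fun n => by simp [hy]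
  have hsum : ∑ m ∈ range N, (y m).natAbs ≤ M := by
    rw [← Fin.sum_univ_eq_sum_range (fun m => (y m).natAbs)]
    zify
    simpa only [hyx] using hx
  have hcost := prefixCost_le hN hM hNM hsum
  have hb2 : 2 ≤ 2 ^ b := by simpa using Nat.pow_le_pow_right (n := 2) (by norm_num) hb
  obtain ⟨g, hg, h⟩ := exists_encoding_network (N := N) (e := b + 2) hb2
    (by rw [pow_add]; omega) hT y (R := 2 * (3 * K / T) + 1) fun n hn => by
      have h1 := Nat.div_le_div_right (c := T)
        ((prefixCost_mono (2 ^ b) y (show n ≤ N by omega)).trans hcost)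
      have h2 := Nat.div_le_div_right (c := T)
        ((prefixCost_mono (2 ^ b) y (show n + 1 ≤ N by omega)).trans hcost)
      unfold groupKey
      omega
  exact ⟨g, hg, fun n => by rw [h n n.2, hyx]⟩

/-- The depth bound in terms of the logarithm of the ratio of the two parameters. -/
theorem width_depth_bound {K P L : ℕ} (hK : 1 ≤ K) (hKP : K ≤ P)
    (hL : L ^ 2 ≤ 4489 * (K * (Nat.log 2 (P / K) + 1))) :
    ((14 : ℕ) : ℝ) ^ 2 * (L : ℝ) ^ 2 ≤ 879844 * K * (1 + Real.logb 2 ((P : ℝ) / K)) := by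
  have hK' : (0 : ℝ) < K := by exact_mod_cast hK
  have hdiv : 1 ≤ P / K := (Nat.one_le_div_iff hK).mpr hKP
  have h1 : (Nat.log 2 (P / K) : ℝ) ≤ Real.logb 2 ((P : ℝ) / K) :=
    (Real.natLog_le_logb _ _).trans
      (Real.logb_le_logb_of_le (by norm_num) (by exact_mod_cast hdiv) Nat.cast_div_le)
  have h2 : (L : ℝ) ^ 2 ≤ 4489 * (K * (Nat.log 2 (P / K) + 1)) := by exact_mod_cast hL
  have h3 := mul_le_mul_of_nonneg_left h1 hK'.le
  push_cast
  linarith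

theorem le_mul_two_pow_log {K P : ℕ} (hK : 1 ≤ K) : P ≤ K * 2 ^ (Nat.log 2 (P / K) + 1) := by
  have h := Nat.lt_pow_succ_log_self (b := 2) (by norm_num) (P / K)
  have h' := Nat.mul_le_mul_left K (Nat.succ_le_of_lt h)
  exact (Nat.lt_mul_div_succ P hK).le.trans h'

theorem encode_SNM : ∃ C : ℝ, 0 < C ∧
    ∀ N M : ℕ, 1 ≤ N → 1 ≤ M →
      ∃ W L : ℕ, 1 ≤ W ∧ 1 ≤ L ∧
        (M ≤ N → ((W : ℝ) ^ 2 * (L : ℝ) ^ 2) ≤ C * M * (1 + Real.logb 2 ((N : ℝ) / M))) ∧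
        (N ≤ M → ((W : ℝ) ^ 2 * (L : ℝ) ^ 2) ≤ C * N * (1 + Real.logb 2 ((M : ℝ) / N))) ∧
        ∀ x : Fin N → ℤ, ∑ n, |x n| ≤ (M : ℤ) →
          ∃ g ∈ NN 1 1 W L, ∀ n : Fin N, g (fun _ => (n : ℝ) + 1) 0 = x n := by
  refine ⟨879844, by norm_num, fun N M hN hM => ?_⟩
  rcases le_total M N with h | h
  · obtain ⟨L, hL, hL2, H⟩ := exists_depth hM (Nat.succ_pos (Nat.log 2 (N / M)))
      (le_mul_two_pow_log hM) (h.trans (le_mul_two_pow_log hM)) (min_le_right N M)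
    refine ⟨14, L, by norm_num, hL, fun _ => width_depth_bound hM h hL2, fun h' => ?_, H⟩
    obtain rfl := le_antisymm h h'
    exact width_depth_bound hM h hL2
  · obtain ⟨L, hL, hL2, H⟩ := exists_depth hN (Nat.succ_pos (Nat.log 2 (M / N)))
      (h.trans (le_mul_two_pow_log hN)) (le_mul_two_pow_log hN) (min_le_left N M)
    refine ⟨14, L, by norm_num, hL, fun h' => ?_, fun _ => width_depth_bound hN h hL2, H⟩
    obtain rfl := le_antisymm h h'
    exact width_depth_bound hN h hL2
end

section
/- (Lower bound, sparse regime) Let p ≥ 1 and C₀ > 0. Then there exists a constant c > 0 depending only on p and C₀ such that the following holds. Suppose N, M, W, L ∈ ℕ satisfy W ≥ 2, L ≥ 1 and N ≥ M ≥ C₀·N^{1/p}, and suppose that for every x = (x₁,…,x_N) ∈ ℤ^N with Σ_{n=1}^N |x_n| ≤ M there exists g ∈ NN_{1,1}(W, L) with g(n) = x_n for all n = 1,…,N. Then W²L²·log(WL) ≥ c·M·(1 + log(N/M)), where log is the natural logarithm. -/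
open MeasureTheory ENNReal Finset

open MvPolynomial in
/-- A family of polynomials of total degree at most `R` which is dual to a family of points has at
most `(R + 1) ^ n` members, where `n` is the number of variables. -/
lemma card_le_of_dual_points {σ ι : Type*} [Fintype σ] [Fintype ι] (h : ι → MvPolynomial σ ℝ)
    (x : ι → σ → ℝ) (R : ℕ) (hdeg : ∀ v, (h v).totalDegree ≤ R)
    (hne : ∀ v, eval (x v) (h v) ≠ 0) (hz : ∀ u v, u ≠ v → eval (x u) (h v) = 0) :
    Fintype.card ι ≤ (R + 1) ^ Fintype.card σ := by
  classical
  have hli : LinearIndependent ℝ h := by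
    rw [Fintype.linearIndependent_iff]
    intro g hg u
    have h1 := congrArg (eval (x u)) hg
    rw [map_sum, map_zero, Finset.sum_eq_single u] at h1
    · rw [smul_eval] at h1
      exact (mul_eq_zero.mp h1).resolve_right (hne u)
    · intro v _ hv
      rw [smul_eval, hz u v hv.symm, mul_zero]
    · simp
  let w : Finset (MvPolynomial σ ℝ) := (Finset.univ : Finset (σ → Fin (R + 1))).image
    fun e => monomial (Finsupp.equivFunOnFinite.symm fun i => (e i : ℕ)) 1
  have hspan : Set.range h ≤ Submodule.span ℝ (w : Set (MvPolynomial σ ℝ)) := by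
    rintro _ ⟨v, rfl⟩
    rw [(h v).as_sum]
    refine Submodule.sum_mem _ fun s hs => ?_
    have hsi : ∀ i, s i < R + 1 := fun i => by
      have h1 := le_totalDegree hs
      have h2 : s i ≤ s.sum fun _ e => e := by
        rw [Finsupp.sum_fintype _ _ (fun _ => rfl)]
        exact Finset.single_le_sum (f := fun i => s i) (fun _ _ => Nat.zero_le _)
          (Finset.mem_univ i)
      have := hdeg v
      omega
    have hmon : monomial s (coeff s (h v)) = coeff s (h v) • monomial s (1 : ℝ) := by
      rw [smul_monomial, smul_eq_mul, mul_one]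
    rw [hmon]
    refine Submodule.smul_mem _ _ (Submodule.subset_span ?_)
    simp only [w, Finset.coe_image, Finset.coe_univ, Set.image_univ, Set.mem_range]
    refine ⟨fun i => ⟨s i, hsi i⟩, ?_⟩
    rw [show Finsupp.equivFunOnFinite.symm (fun i => s i) = s from
      Finsupp.equivFunOnFinite.symm_apply_apply s]
  have hc := linearIndependent_le_span' h hli (w : Set (MvPolynomial σ ℝ)) hspan
  rw [Cardinal.mk_fintype, Nat.cast_le] at hc
  refine hc.trans ?_
  have : Fintype.card (w : Set (MvPolynomial σ ℝ)) = w.card := by simp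
  rw [this]
  refine Finset.card_image_le.trans ?_
  simp

open MvPolynomial in
lemma totalDegree_pderiv_le {σ : Type*} (i : σ) (F : MvPolynomial σ ℝ) :
    (pderiv i F).totalDegree ≤ F.totalDegree := by
  rw [totalDegree]
  refine Finset.sup_le fun s hs => ?_
  rw [mem_support_iff, coeff_pderiv] at hs
  have h1 : s + Finsupp.single i 1 ∈ F.support := by
    rw [mem_support_iff]
    exact left_ne_zero_of_mul hs
  refine le_trans ?_ (le_totalDegree h1)
  rw [Finsupp.sum_add_index' (fun _ => rfl) (fun _ _ _ => rfl)]
  exact Nat.le_add_right _ _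

open MvPolynomial in
/-- If for every `a` the rational map `x ↦ x - ∇F(x) / F(x)` takes the value `a` at least
`card κ` times, then `card κ` is bounded in terms of the degree of `F`. -/
lemma card_le_of_critical_points {σ κ : Type*} [Fintype σ] [Fintype κ] (F : MvPolynomial σ ℝ)
    (Δ : ℕ) (hF : F.totalDegree ≤ Δ)
    (hcrit : ∀ a : σ → ℝ, ∃ x : κ → σ → ℝ, Function.Injective x ∧ ∀ j, eval (x j) F ≠ 0 ∧
      ∀ i, eval (x j) (pderiv i F) = (x j i - a i) * eval (x j) F) :
    Fintype.card κ ≤ ((Fintype.card σ + 1) * (Δ + 1)) ^ Fintype.card σ := by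
  classical
  rcases Nat.eq_zero_or_pos (Fintype.card κ) with hK0 | hKpos
  · rw [hK0]; exact Nat.zero_le _
  set K := Fintype.card κ with hK
  set P := Fintype.card σ with hP
  choose x hinj hx using fun a : σ → Fin (K + 1) => hcrit fun i => ((a i : ℕ) : ℝ)
  have hsep : ∀ a j j', ∃ q : MvPolynomial σ ℝ, q.totalDegree ≤ 1 ∧
      (j ≠ j' → eval (x a j') q = 0 ∧ eval (x a j) q ≠ 0) := by
    intro a j j'
    by_cases hjj : j = j'
    · exact ⟨0, by simp, fun h => absurd hjj h⟩
    · obtain ⟨i, hi⟩ := Function.ne_iff.mp fun h => hjj (hinj a h)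
      refine ⟨X i - C (x a j' i), ?_, fun _ => ⟨by simp, ?_⟩⟩
      · exact (totalDegree_sub_C_le _ _).trans (totalDegree_X _).le
      · simpa [sub_eq_zero] using hi
  choose q hq1 hq using hsep
  let r : σ → Fin (K + 1) → MvPolynomial σ ℝ := fun i b =>
    X i * F - pderiv i F - C ((b : ℕ) : ℝ) * F
  have hrdeg : ∀ i b, (r i b).totalDegree ≤ Δ + 1 := by
    intro i b
    have h1 : (X i * F).totalDegree ≤ Δ + 1 :=
      (totalDegree_mul _ _).trans (by rw [totalDegree_X]; omega)
    have h2 : (pderiv i F).totalDegree ≤ Δ + 1 := (totalDegree_pderiv_le i F).trans (by omega)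
    have h3 : (C ((b : ℕ) : ℝ) * F).totalDegree ≤ Δ + 1 :=
      (totalDegree_mul _ _).trans (by rw [totalDegree_C]; omega)
    exact (totalDegree_sub _ _).trans (max_le ((totalDegree_sub _ _).trans (max_le h1 h2)) h3)
  have hreval : ∀ i b a j, eval (x a j) (r i b) =
      (((a i : ℕ) : ℝ) - ((b : ℕ) : ℝ)) * eval (x a j) F := by
    intro i b a j
    simp only [r, map_sub, map_mul, eval_X, eval_C, (hx a j).2 i]
    ring
  let h : (σ → Fin (K + 1)) × κ → MvPolynomial σ ℝ := fun u =>
    (∏ i, ∏ b ∈ Finset.univ.erase (u.1 i), r i b) * ∏ j' ∈ Finset.univ.erase u.2, q u.1 u.2 j'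
  have hmain := card_le_of_dual_points h (fun u => x u.1 u.2) (P * (K * (Δ + 1)) + (K - 1)) ?_ ?_ ?_
  · rw [Fintype.card_prod, Fintype.card_fun, Fintype.card_fin, ← hK, ← hP] at hmain
    have h1 : P * (K * (Δ + 1)) + (K - 1) + 1 ≤ K * ((P + 1) * (Δ + 1)) := by
      have : K - 1 + 1 = K := by omega
      rw [add_assoc, this]
      nlinarith [Nat.zero_le (K * Δ)]
    have h2 := hmain.trans (Nat.pow_le_pow_left h1 P)
    rw [mul_pow] at h2
    have h3 : K ^ P * K ≤ K ^ P * ((P + 1) * (Δ + 1)) ^ P :=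
      (Nat.mul_le_mul_right K (Nat.pow_le_pow_left (Nat.le_succ K) P)).trans h2
    exact Nat.le_of_mul_le_mul_left h3 (pow_pos hKpos P)
  · intro u
    refine (totalDegree_mul _ _).trans (add_le_add ?_ ?_)
    · refine (totalDegree_finsetProd _ _).trans ?_
      refine (Finset.sum_le_card_nsmul _ _ (K * (Δ + 1)) fun i _ => ?_).trans (by simp [hP])
      refine (totalDegree_finsetProd _ _).trans ?_
      refine (Finset.sum_le_card_nsmul _ _ (Δ + 1) fun b _ => hrdeg i b).trans (by simp)
    · refine (totalDegree_finsetProd _ _).trans ?_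
      refine (Finset.sum_le_card_nsmul _ _ 1 fun b _ => hq1 _ _ _).trans (by simp [hK])
  · intro u
    simp only [h, map_mul, map_prod]
    refine mul_ne_zero (Finset.prod_ne_zero_iff.mpr fun i _ => Finset.prod_ne_zero_iff.mpr
      fun b hb => ?_) (Finset.prod_ne_zero_iff.mpr fun j' hj' => ?_)
    · rw [hreval]
      refine mul_ne_zero ?_ (hx _ _).1
      rw [sub_ne_zero]
      intro hab
      exact (Finset.ne_of_mem_erase hb) (Fin.ext (by exact_mod_cast hab.symm))
    · exact (hq _ _ _ (Finset.ne_of_mem_erase hj').symm).2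
  · rintro ⟨a', j'⟩ ⟨a, j⟩ hne
    simp only [h, map_mul, map_prod]
    by_cases haa : a' = a
    · subst haa
      have hjj : j ≠ j' := fun h => hne (by rw [h])
      rw [Finset.prod_eq_zero (i := j') (s := Finset.univ.erase j) (by simp [hjj.symm])
        (hq _ _ _ hjj).1, mul_zero]
    · obtain ⟨i, hi⟩ := Function.ne_iff.mp haa
      rw [Finset.prod_eq_zero (Finset.mem_univ i), zero_mul]
      refine Finset.prod_eq_zero (i := a' i) (by simp [hi]) ?_
      rw [hreval, sub_self, zero_mul]

open MvPolynomial in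
lemma hasDerivAt_eval_update {σ : Type*} [DecidableEq σ] (F : MvPolynomial σ ℝ) (x : σ → ℝ)
    (i : σ) : HasDerivAt (fun t => eval (Function.update x i t) F) (eval x (pderiv i F)) (x i) := by
  induction F using MvPolynomial.induction_on with
  | C a => simpa using hasDerivAt_const (x i) a
  | add p q hp hq => simpa using! hp.add hq
  | mul_X p j hp =>
    have hX : HasDerivAt (fun t => Function.update x i t j) (eval x (pderiv i (X j))) (x i) := by
      by_cases hij : j = i
      · subst hij
        simpa using! hasDerivAt_id (x j)
      · simpa [Function.update_of_ne hij, pderiv_X_of_ne hij] using hasDerivAt_const (x i) (x j)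
    have := hp.mul hX
    simp only [map_mul, eval_X, pderiv_mul, map_add]
    simpa [Function.update_eq_self] using! this

open MvPolynomial in
lemma abs_eval_le_exp {σ : Type*} [Fintype σ] (F : MvPolynomial σ ℝ) (a : σ → ℝ) :
    ∀ ε > 0, ∃ C, 0 ≤ C ∧ ∀ x : σ → ℝ, |eval x F| ≤ C * Real.exp (ε * ∑ i, (x i - a i) ^ 2) := by
  induction F using MvPolynomial.induction_on with
  | C b =>
    intro ε hε
    refine ⟨|b|, abs_nonneg b, fun x => ?_⟩
    rw [eval_C]
    refine le_mul_of_one_le_right (abs_nonneg b) (Real.one_le_exp ?_)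
    exact mul_nonneg hε.le (Finset.sum_nonneg fun i _ => sq_nonneg _)
  | add p q hp hq =>
    intro ε hε
    obtain ⟨C₁, h₁, hp⟩ := hp ε hε
    obtain ⟨C₂, h₂, hq⟩ := hq ε hε
    refine ⟨C₁ + C₂, add_nonneg h₁ h₂, fun x => ?_⟩
    rw [map_add, add_mul]
    exact (abs_add_le _ _).trans (add_le_add (hp x) (hq x))
  | mul_X p j hp =>
    intro ε hε
    obtain ⟨C₁, h₁, hp⟩ := hp (ε / 2) (half_pos hε)
    refine ⟨C₁ * (|a j| + 1 + 2 / ε), by positivity, fun x => ?_⟩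
    set S := ∑ i, (x i - a i) ^ 2 with hS
    have hSj : (x j - a j) ^ 2 ≤ S :=
      Finset.single_le_sum (f := fun i => (x i - a i) ^ 2) (fun i _ => sq_nonneg _)
        (Finset.mem_univ j)
    have hS0 : 0 ≤ S := (sq_nonneg _).trans hSj
    have hxj : |x j| ≤ (|a j| + 1 + 2 / ε) * Real.exp (ε / 2 * S) := by
      have h1 : |x j| ≤ |a j| + |x j - a j| := by
        have := abs_add_le (a j) (x j - a j)
        rwa [add_sub_cancel] at this
      have h2 : |x j - a j| ≤ 1 + S := by
        rw [← sq_abs] at hSj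
        nlinarith [sq_nonneg (|x j - a j| - 1), abs_nonneg (x j - a j)]
      have h3 : ε / 2 * S ≤ Real.exp (ε / 2 * S) := by
        linarith [Real.add_one_le_exp (ε / 2 * S)]
      have h4 : S ≤ 2 / ε * Real.exp (ε / 2 * S) := by
        have : S = 2 / ε * (ε / 2 * S) := by field_simp
        calc S = 2 / ε * (ε / 2 * S) := this
          _ ≤ _ := by gcongr
      have h5 : 1 ≤ Real.exp (ε / 2 * S) := Real.one_le_exp (by positivity)
      nlinarith [abs_nonneg (a j)]
    rw [map_mul, eval_X, abs_mul]
    calc |eval x p| * |x j| ≤ (C₁ * Real.exp (ε / 2 * S)) *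
          ((|a j| + 1 + 2 / ε) * Real.exp (ε / 2 * S)) :=
          mul_le_mul (hp x) hxj (abs_nonneg _) (by positivity)
      _ = _ := by
        rw [show ε * S = ε / 2 * S + ε / 2 * S by ring, Real.exp_add]; ring

open MvPolynomial in
lemma tendsto_eval_mul_gaussian {σ : Type*} [Fintype σ] (F : MvPolynomial σ ℝ) (a : σ → ℝ) :
    Filter.Tendsto (fun x : σ → ℝ => |eval x F| * Real.exp (-(∑ i, (x i - a i) ^ 2) / 2))
      (Filter.cocompact _) (nhds 0) := by
  obtain ⟨C, hC, hb⟩ := abs_eval_le_exp F a (1 / 4) (by norm_num)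
  have hS : Filter.Tendsto (fun x : σ → ℝ => ∑ i, (x i - a i) ^ 2) (Filter.cocompact _)
      Filter.atTop := by
    have h1 : Filter.Tendsto (fun x : σ → ℝ => ‖x - a‖) (Filter.cocompact _) Filter.atTop :=
      tendsto_norm_cocompact_atTop.comp (Homeomorph.subRight a).isClosedEmbedding.tendsto_cocompact
    refine Filter.tendsto_atTop_mono (fun x => ?_) (Filter.tendsto_atTop_add_const_right _ (-1) h1)
    rw [← sub_eq_add_neg, sub_le_iff_le_add]
    refine (pi_norm_le_iff_of_nonneg ?_).mpr fun i => ?_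
    · exact add_nonneg (Finset.sum_nonneg fun i _ => sq_nonneg _) zero_le_one
    · have hSj : (x i - a i) ^ 2 ≤ ∑ i, (x i - a i) ^ 2 :=
        Finset.single_le_sum (f := fun i => (x i - a i) ^ 2) (fun i _ => sq_nonneg _)
          (Finset.mem_univ i)
      rw [← sq_abs] at hSj
      rw [Pi.sub_apply, Real.norm_eq_abs]
      nlinarith [sq_nonneg (|x i - a i| - 1), abs_nonneg (x i - a i)]
  have h2 : Filter.Tendsto (fun x : σ → ℝ => C * Real.exp (-(1 / 4 * ∑ i, (x i - a i) ^ 2)))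
      (Filter.cocompact _) (nhds 0) := by
    have := (Real.tendsto_exp_neg_atTop_nhds_zero.comp
      (hS.const_mul_atTop (show (0 : ℝ) < 1 / 4 by norm_num))).const_mul C
    simpa using this
  refine squeeze_zero (fun x => by positivity) (fun x => ?_) h2
  calc _ ≤ (C * Real.exp (1 / 4 * ∑ i, (x i - a i) ^ 2)) *
        Real.exp (-(∑ i, (x i - a i) ^ 2) / 2) := by gcongr; exact hb x
    _ = _ := by
      rw [mul_assoc, ← Real.exp_add]
      congr 2; ring

open MvPolynomial in
/-- Every nonempty cell of strict signs of the polynomials `f i` contains a critical point of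
`x ↦ (∏ i, f i x) * exp (-‖x - a‖² / 2)`. -/
lemma exists_critical_point {σ ι : Type*} [Fintype σ] [Fintype ι] (f : ι → MvPolynomial σ ℝ)
    (e : ι → ℝ) (a x₀ : σ → ℝ) (h₀ : ∀ i, 0 < e i * eval x₀ (f i)) :
    ∃ x : σ → ℝ, (∀ i, 0 < e i * eval x (f i)) ∧
      ∀ j, eval x (pderiv j (∏ i, f i)) = (x j - a j) * eval x (∏ i, f i) := by
  classical
  set c := ∏ i, e i with hc
  set F := ∏ i, f i with hF
  have hcF : ∀ x, c * eval x F = ∏ i, e i * eval x (f i) := fun x => by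
    rw [hc, hF, map_prod, Finset.prod_mul_distrib]
  let S : (σ → ℝ) → ℝ := fun x => ∑ i, (x i - a i) ^ 2
  let G : (σ → ℝ) → ℝ := fun x => c * eval x F * Real.exp (-S x / 2)
  let s : Set (σ → ℝ) := {x | ∀ i, 0 ≤ e i * eval x (f i)}
  have hcont : ∀ p : MvPolynomial σ ℝ, Continuous fun x : σ → ℝ => eval x p :=
    fun p => MvPolynomial.continuous_eval p
  have hGc : Continuous G := by
    have := hcont F
    fun_prop
  have hsc : IsClosed s := by
    simp only [s, Set.ofPred_forall]
    exact isClosed_iInter fun i =>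
      isClosed_le continuous_const (continuous_const.mul (hcont (f i)))
  have hG₀ : 0 < G x₀ := by
    simp only [G, hcF]
    exact mul_pos (Finset.prod_pos fun i _ => h₀ i) (Real.exp_pos _)
  have hev : ∀ᶠ x in Filter.cocompact (σ → ℝ) ⊓ Filter.principal s, G x ≤ G x₀ := by
    refine Filter.Eventually.filter_mono inf_le_left ?_
    filter_upwards [(tendsto_eval_mul_gaussian (C c * F) a).eventually_lt_const hG₀] with x hx
    refine le_trans ?_ hx.le
    simp only [G, S, map_mul, eval_C]
    gcongr
    exact le_abs_self _
  obtain ⟨x, hxs, hmax⟩ :=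
    hGc.continuousOn.exists_isMaxOn' hsc (x₀ := x₀) (fun i => (h₀ i).le) hev
  have hGx : 0 < G x := hG₀.trans_le (hmax (fun i => (h₀ i).le : x₀ ∈ s))
  have hcFx : c * eval x F ≠ 0 := fun h => by simp [G, h] at hGx
  have hpos : ∀ i, 0 < e i * eval x (f i) := fun i => by
    refine lt_of_le_of_ne (hxs i) (Ne.symm ?_)
    rw [hcF] at hcFx
    exact Finset.prod_ne_zero_iff.mp hcFx i (Finset.mem_univ i)
  refine ⟨x, hpos, fun j => ?_⟩
  have hnhds : s ∈ nhds x := by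
    have : ∀ᶠ y in nhds x, ∀ i, 0 < e i * eval y (f i) := by
      rw [Filter.eventually_all]
      exact fun i => (continuous_const.mul (hcont (f i))).continuousAt.eventually_const_lt (hpos i)
    filter_upwards [this] with y hy i using (hy i).le
  have hloc : IsLocalMax (fun t => G (Function.update x j t)) (x j) := by
    have hu : Filter.Tendsto (fun t => Function.update x j t) (nhds (x j)) (nhds x) := by
      have : Continuous fun t : ℝ => Function.update x j t := by fun_prop
      simpa using this.tendsto (x j)
    filter_upwards [hu.eventually (hmax.isLocalMax hnhds)] with t ht
    simpa using ht
  have hSd : HasDerivAt (fun t => S (Function.update x j t)) (2 * (x j - a j)) (x j) := by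
    have := hasDerivAt_eval_update (∑ i, (X i - C (a i)) ^ 2 : MvPolynomial σ ℝ) x j
    simpa [S, map_sum, Derivation.leibniz_pow, pderiv_X, Pi.single_apply] using! this
  have hFd := hasDerivAt_eval_update F x j
  have hd := (hFd.const_mul c).mul ((hSd.neg.div_const 2).exp)
  have h0 := hloc.hasDerivAt_eq_zero hd
  simp only [Function.update_eq_self] at h0
  have hE := Real.exp_pos (-S x / 2)
  have h1 : (c * Real.exp (-S x / 2)) *
      (eval x (pderiv j F) - (x j - a j) * eval x F) = 0 := by
    simp only [Pi.neg_apply, Function.update_eq_self] at h0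
    linear_combination h0
  exact sub_eq_zero.mp
    ((mul_eq_zero.mp h1).resolve_left (mul_ne_zero (left_ne_zero_of_mul hcFx) hE.ne'))

open MvPolynomial in
/-- A Warren-type bound for the number of sign patterns of a family of real polynomials. -/
lemma ncard_sign_patterns_le {σ ι : Type*} [Fintype σ] [Fintype ι] (f : ι → MvPolynomial σ ℝ)
    (D : ℕ) (hD : ∀ i, (f i).totalDegree ≤ D) :
    (Set.range fun θ : σ → ℝ => {i | 0 ≤ eval θ (f i)}).ncard ≤
      ((Fintype.card σ + 1) * (Fintype.card ι * D + 1)) ^ Fintype.card σ := by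
  classical
  let κ := Set.range fun θ : σ → ℝ => {i | 0 ≤ eval θ (f i)}
  have : Fintype κ := Fintype.ofFinite κ
  choose w hw using fun S : κ => S.2
  have hmem : ∀ (S : κ) i, i ∈ S.1 ↔ 0 ≤ eval (w S) (f i) := fun S i => by
    rw [← hw S]; rfl
  have hε : ∃ ε > 0, ∀ (S : κ) i, i ∉ S.1 → eval (w S) (f i) + ε < 0 := by
    have : ∀ᶠ ε in nhdsWithin (0 : ℝ) (Set.Ioi 0), ∀ (S : κ) i, i ∉ S.1 →
        eval (w S) (f i) + ε < 0 := by
      refine Filter.Eventually.filter_mono nhdsWithin_le_nhds ?_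
      simp only [Filter.eventually_all]
      intro S i hi
      rw [hmem, not_le] at hi
      have hc : ContinuousAt (fun ε : ℝ => eval (w S) (f i) + ε) 0 := by fun_prop
      exact hc.eventually_lt_const (by simpa using hi)
    obtain ⟨ε, h1, h2⟩ := (this.and self_mem_nhdsWithin).exists
    exact ⟨ε, h2, h1⟩
  obtain ⟨ε, hε, hneg⟩ := hε
  let g : ι → MvPolynomial σ ℝ := fun i => f i + C ε
  let e : κ → ι → ℝ := fun S i => if i ∈ S.1 then 1 else -1
  have hsign : ∀ (S : κ) i, 0 < e S i * eval (w S) (g i) := by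
    intro S i
    simp only [e, g, map_add, eval_C]
    split_ifs with hi
    · have := (hmem S i).mp hi
      linarith
    · have := hneg S i hi
      linarith
  have hcard : κ.ncard = Fintype.card κ := by
    rw [← Nat.card_coe_set_eq, Nat.card_eq_fintype_card]
  change κ.ncard ≤ _
  rw [hcard]
  refine card_le_of_critical_points (∏ i, g i) _ ?_ fun a => ?_
  · refine (totalDegree_finsetProd _ _).trans ?_
    refine (Finset.sum_le_card_nsmul _ _ D fun i _ => ?_).trans (by simp)
    exact (totalDegree_add _ _).trans (by simp [hD i])
  · choose x hx hcrit using fun S : κ => exists_critical_point g (e S) a (w S) (hsign S)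
    refine ⟨x, fun S T hST => ?_, fun S => ⟨?_, hcrit S⟩⟩
    · ext i
      have h1 := hx S i
      have h2 := hx T i
      rw [hST] at h1
      simp only [e] at h1 h2
      split_ifs at h1 h2 with h3 h4 h4
      · simp [h3, h4]
      · linarith
      · linarith
      · simp [h3, h4]
    · rw [map_prod]
      exact Finset.prod_ne_zero_iff.mpr fun i _ => right_ne_zero_of_mul (hx S i).ne'

/-- The affine map on `ℝ^W` with weights `w i (some j)` and biases `w i none`. -/
def affineLayer {W : ℕ} (w : Fin W → Option (Fin W) → ℝ) (v : Fin W → ℝ) : Fin W → ℝ :=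
  fun i => (∑ j, w i (some j) * v j) + w i none

/-- The ReLU network with `L` hidden layers in which all layers have the same width. -/
def squareNet {W : ℕ} :
    (L : ℕ) → (Fin (L + 1) → Fin W → Option (Fin W) → ℝ) → (Fin W → ℝ) → (Fin W → ℝ)
  | 0, w, v => affineLayer (w 0) v
  | (L + 1), w, v => squareNet L (fun l => w l.succ) fun i => relu (affineLayer (w 0) v i)

/-- Extension of a vector by zeros. -/
def padZero (W : ℕ) {d : ℕ} (v : Fin d → ℝ) : Fin W → ℝ :=
  fun i => if h : (i : ℕ) < d then v ⟨i, h⟩ else 0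

lemma exists_affineLayer_padZero {n m W : ℕ} (hn : n ≤ W) {A : (Fin n → ℝ) → (Fin m → ℝ)}
    (hA : IsAffineMap A) :
    ∃ w : Fin W → Option (Fin W) → ℝ, ∀ x, affineLayer w (padZero W x) = padZero W (A x) := by
  obtain ⟨M, c, hA⟩ := hA
  refine ⟨fun i o => if hi : (i : ℕ) < m then
    o.elim (c ⟨i, hi⟩) (fun j => if hj : (j : ℕ) < n then M ⟨i, hi⟩ ⟨j, hj⟩ else 0) else 0,
    fun x => ?_⟩
  funext i
  by_cases hi : (i : ℕ) < m
  · simp only [affineLayer, padZero, hi, dite_true, Option.elim, hA]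
    congr 1
    symm
    refine Fintype.sum_of_injective (Fin.castLE hn) (Fin.castLE_injective hn) _ _ ?_ ?_
    · intro j hj
      have : ¬ (j : ℕ) < n := fun h => hj ⟨⟨j, h⟩, rfl⟩
      simp [this]
    · intro j
      simp
  · simp [affineLayer, padZero, hi]

lemma exists_squareNet_of_mem_NNaux {k W : ℕ} (hk : k ≤ W) (L : ℕ) :
    ∀ (d : ℕ), d ≤ W → ∀ g ∈ NNaux k W L d, ∃ w : Fin (L + 1) → Fin W → Option (Fin W) → ℝ,
      ∀ x i, squareNet L w (padZero W x) (Fin.castLE hk i) = g x i := by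
  induction L with
  | zero =>
    intro d hd g hg
    obtain ⟨w, hw⟩ := exists_affineLayer_padZero hd hg
    refine ⟨fun _ => w, fun x i => ?_⟩
    simp [squareNet, hw, padZero]
  | succ L ih =>
    rintro d hd g ⟨n, -, hn, A, h, hA, hh, rfl⟩
    obtain ⟨w₀, hw₀⟩ := exists_affineLayer_padZero hd hA
    obtain ⟨w, hw⟩ := ih n hn h hh
    refine ⟨Fin.cons w₀ w, fun x i => ?_⟩
    change _ = h (fun i => relu (A x i)) i
    rw [← hw]
    have : (fun i => relu (affineLayer w₀ (padZero W x) i)) =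
        padZero W fun i => relu (A x i) := by
      funext i
      rw [hw₀]
      by_cases hi : (i : ℕ) < n <;> simp [padZero, hi, relu]
    simp only [squareNet, Fin.cons_zero, Fin.cons_succ, this]

open MvPolynomial in
/-- A bound for the number of threshold patterns of a ReLU network as its weights vary. -/
lemma ncard_squareNet_patterns_le {σ ν : Type*} [Fintype σ] [Fintype ν] {W : ℕ} (i₀ : Fin W)
    (τ : ℝ) (L : ℕ) :
    ∀ (y : Fin (L + 1) → Fin W → Option (Fin W) → σ) (D : ℕ)
      (q : ν → Fin W → MvPolynomial σ ℝ), (∀ n i, (q n i).totalDegree ≤ D) →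
      (Set.range fun θ : σ → ℝ => {n | τ ≤ squareNet L (fun l i o => θ (y l i o))
        (fun i => eval θ (q n i)) i₀}).ncard ≤
      (((Fintype.card σ + 1) * (Fintype.card ν * W * (D + L + 1) + 1)) ^ Fintype.card σ)
        ^ (L + 1) := by
  classical
  have hW : 1 ≤ W := Nat.one_le_of_lt i₀.2
  have hlayer : ∀ (w : Fin W → Option (Fin W) → σ) (D : ℕ) (q : ν → Fin W → MvPolynomial σ ℝ),
      (∀ n i, (q n i).totalDegree ≤ D) → ∃ r : ν → Fin W → MvPolynomial σ ℝ,
        (∀ n i, (r n i).totalDegree ≤ D + 1) ∧ ∀ (θ : σ → ℝ) n i,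
          affineLayer (fun i o => θ (w i o)) (fun i => eval θ (q n i)) i = eval θ (r n i) := by
    intro w D q hq
    refine ⟨fun n i => (∑ j, X (w i (some j)) * q n j) + X (w i none), fun n i => ?_,
      fun θ n i => by simp [affineLayer]⟩
    refine (totalDegree_add _ _).trans (max_le (totalDegree_finsetSum_le fun j _ => ?_) ?_)
    · refine (totalDegree_mul _ _).trans ?_
      rw [totalDegree_X]
      have := hq n j
      omega
    · rw [totalDegree_X]
      omega
  induction L with
  | zero =>
    intro y D q hq
    obtain ⟨r, hr, hre⟩ := hlayer (y 0) D q hq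
    have h := ncard_sign_patterns_le (fun n => r n i₀ - C τ) (D + 1)
      fun n => (totalDegree_sub_C_le _ _).trans (hr n i₀)
    simp only [squareNet, hre, zero_add, pow_one, add_zero]
    simp only [map_sub, eval_C, sub_nonneg] at h
    refine h.trans ?_
    gcongr
    exact Nat.le_mul_of_pos_right _ hW
  | succ L ih =>
    intro y D q hq
    obtain ⟨r, hr, hre⟩ := hlayer (y 0) D q hq
    let A : (σ → ℝ) → Set (ν × Fin W) := fun θ => {u | 0 ≤ eval θ (r u.1 u.2)}
    let q' : Set (ν × Fin W) → ν → Fin W → MvPolynomial σ ℝ := fun S n i =>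
      if (n, i) ∈ S then r n i else 0
    have hq' : ∀ S n i, (q' S n i).totalDegree ≤ D + 1 := by
      intro S n i
      simp only [q']
      split_ifs
      · exact hr n i
      · simp
    have hA := ncard_sign_patterns_le (fun u : ν × Fin W => r u.1 u.2) (D + 1) fun u => hr _ _
    let T : Set (ν × Fin W) → Set (Set ν) := fun S => Set.range fun θ : σ → ℝ =>
      {n | τ ≤ squareNet L (fun l i o => θ (y l.succ i o)) (fun i => eval θ (q' S n i)) i₀}
    set B := (((Fintype.card σ + 1) * (Fintype.card ν * W * (D + 1 + L + 1) + 1)) ^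
      Fintype.card σ) with hB
    have hT : ∀ S, (T S).ncard ≤ B ^ (L + 1) :=
      fun S => ih (fun l => y l.succ) (D + 1) (q' S) (hq' S)
    have hsub : (Set.range fun θ : σ → ℝ => {n | τ ≤ squareNet (L + 1)
        (fun l i o => θ (y l i o)) (fun i => eval θ (q n i)) i₀}) ⊆
        ((Set.range A).toFinset.biUnion fun S => (T S).toFinset : Finset (Set ν)) := by
      rintro _ ⟨θ, rfl⟩
      simp only [Finset.coe_biUnion, Set.mem_iUnion, Set.coe_toFinset]
      refine ⟨A θ, ⟨θ, rfl⟩, θ, ?_⟩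
      have : ∀ n, (fun i => eval θ (q' (A θ) n i)) =
          fun i => relu (eval θ (r n i)) := by
        intro n
        funext i
        by_cases h : 0 ≤ eval θ (r n i)
        · have h' : (n, i) ∈ A θ := h
          simp [q', h', relu, h]
        · have h' : (n, i) ∉ A θ := h
          simp [q', h', relu, (not_le.mp h).le]
      simp only [squareNet, hre, this]
    refine (Set.ncard_le_ncard hsub (Finset.finite_toSet _)).trans ?_
    rw [Set.ncard_coe_finset]
    refine (Finset.card_biUnion_le_card_mul _ _ (B ^ (L + 1)) fun S _ => ?_).trans ?_
    · rw [← Set.ncard_eq_toFinset_card']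
      exact hT S
    · rw [← Set.ncard_eq_toFinset_card']
      have hAB : (Set.range A).ncard ≤ B := by
        refine hA.trans ?_
        rw [Fintype.card_prod, Fintype.card_fin, hB]
        gcongr
        omega
      calc _ ≤ B * B ^ (L + 1) := Nat.mul_le_mul_right _ hAB
        _ = _ := by rw [← pow_succ', hB, show D + 1 + L + 1 = D + (L + 1) + 1 by ring]

/-- The subset of `Fin N` which selects, in the `b`-th of `M` consecutive blocks of length `q`,
the `c b`-th element if `c b ≠ 0` and no element otherwise. -/
def blockSet (N : ℕ) {M q : ℕ} (c : Fin M → Fin (q + 1)) : Set (Fin N) :=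
  {n | ∃ b : Fin M, (c b : ℕ) ≠ 0 ∧ (n : ℕ) + 1 = b * q + c b}

lemma block_ext {q b b' u u' : ℕ} (hu : u ≠ 0) (hu' : u' ≠ 0) (huq : u ≤ q) (huq' : u' ≤ q)
    (h : b * q + u = b' * q + u') : b = b' ∧ u = u' := by
  have key : ∀ {b b' u u' : ℕ}, u' ≠ 0 → u ≤ q → b * q + u = b' * q + u' → b' ≤ b := by
    intro b b' u u' hu' hu h
    by_contra! hlt
    have := Nat.mul_le_mul_right q hlt
    rw [Nat.succ_mul] at this
    omega
  have hb := le_antisymm (key hu huq' h.symm) (key hu' huq h)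
  subst hb
  exact ⟨rfl, by omega⟩

lemma blockSet_injective {N M q : ℕ} (hN : M * q ≤ N) :
    Function.Injective (blockSet N : (Fin M → Fin (q + 1)) → Set (Fin N)) := by
  have key : ∀ c c' : Fin M → Fin (q + 1), blockSet N c = blockSet N c' →
      ∀ b, (c b : ℕ) ≠ 0 → c' b = c b := by
    intro c c' h b hb
    have hlt : (b : ℕ) * q + c b ≤ M * q := by
      have h1 := Nat.mul_le_mul_right q (Nat.succ_le_of_lt b.2)
      rw [Nat.succ_mul] at h1
      have := (c b).is_le
      omega
    have hmem : (⟨b * q + c b - 1, by omega⟩ : Fin N) ∈ blockSet N c :=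
      ⟨b, hb, by dsimp only; omega⟩
    rw [h] at hmem
    obtain ⟨b', hb', hbb⟩ := hmem
    have heq : (b : ℕ) * q + c b = b' * q + c' b' := by dsimp only at hbb; omega
    obtain ⟨h1, h2⟩ := block_ext hb hb' (c b).is_le (c' b').is_le heq
    obtain rfl := Fin.ext h1
    exact (Fin.ext h2).symm
  intro c c' h
  funext b
  by_cases hb : (c b : ℕ) = 0
  · by_cases hb' : (c' b : ℕ) = 0
    · exact Fin.ext (hb.trans hb'.symm)
    · exact key c' c h.symm b hb'
  · exact (key c c' h b hb).symm

open Classical in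
lemma card_blockSet_le {N M q : ℕ} (c : Fin M → Fin (q + 1)) :
    ({n | n ∈ blockSet N c} : Finset (Fin N)).card ≤ M := by
  have h : ∀ n : Fin N, ∃ b : Option (Fin M), n ∈ blockSet N c →
      ∃ b', b = some b' ∧ (n : ℕ) + 1 = b' * q + c b' := by
    intro n
    by_cases hn : n ∈ blockSet N c
    · obtain ⟨b, -, hb⟩ := hn
      exact ⟨some b, fun _ => ⟨b, rfl, hb⟩⟩
    · exact ⟨none, fun h => absurd h hn⟩
  choose f hf using h
  have hcard := Finset.card_le_card_of_injOn (s := ({n | n ∈ blockSet N c} : Finset (Fin N)))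
    (t := (Finset.univ : Finset (Fin M)).image some) f ?_ ?_
  · exact hcard.trans (Finset.card_image_le.trans (by simp))
  · intro n hn
    obtain ⟨b, hb, -⟩ := hf n (by simpa using hn)
    simp [hb]
  · intro n hn m hm hnm
    obtain ⟨b, hb, hb'⟩ := hf n (by simpa using hn)
    obtain ⟨d, hd, hd'⟩ := hf m (by simpa using hm)
    rw [hb, hd, Option.some_inj] at hnm
    subst hnm
    exact Fin.ext (by omega)

/-- Representing all sparse integer vectors forces many threshold patterns. -/
lemma pow_le_of_representable {N M W L : ℕ} (hW : 2 ≤ W)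
    (hrep : ∀ x : Fin N → ℤ, ∑ n, |x n| ≤ (M : ℤ) →
      ∃ g ∈ NN 1 1 W L, ∀ n : Fin N, g (fun _ => (n : ℝ) + 1) 0 = x n) :
    (N / M + 1) ^ M ≤
      ((((L + 1) * (W * (W + 1)) + 1) * (N * W * (L + 1) + 1)) ^ ((L + 1) * (W * (W + 1))))
        ^ (L + 1) := by
  classical
  have hW1 : 1 ≤ W := by omega
  let σ := Fin (L + 1) × Fin W × Option (Fin W)
  let i₀ : Fin W := Fin.castLE hW1 0
  have hbound := ncard_squareNet_patterns_le (σ := σ) i₀ (1 / 2) L (fun l i o => (l, i, o)) 0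
    (fun (n : Fin N) i => MvPolynomial.C (padZero W (fun _ : Fin 1 => (n : ℝ) + 1) i))
    (fun n i => by simp)
  simp only [MvPolynomial.eval_C] at hbound
  have hσ : Fintype.card σ = (L + 1) * (W * (W + 1)) := by simp [σ]
  rw [hσ, Fintype.card_fin, zero_add] at hbound
  refine le_trans ?_ hbound
  have hcard : (Set.range (blockSet N : (Fin M → Fin (N / M + 1)) → Set (Fin N))).ncard =
      (N / M + 1) ^ M := by
    rw [← Set.image_univ, Set.ncard_image_of_injective _
      (blockSet_injective (Nat.mul_div_le N M)), Set.ncard_univ]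
    simp
  rw [← hcard]
  refine Set.ncard_le_ncard ?_ (Set.toFinite _)
  rintro _ ⟨c, rfl⟩
  obtain ⟨g, hg, hgx⟩ := hrep (fun n => if n ∈ blockSet N c then 1 else 0) (by
    have : ∀ n, |if n ∈ blockSet N c then (1 : ℤ) else 0| = if n ∈ blockSet N c then 1 else 0 :=
      fun n => by split_ifs <;> simp
    simp only [this, Finset.sum_boole]
    exact_mod_cast card_blockSet_le c)
  obtain ⟨w, hw⟩ := exists_squareNet_of_mem_NNaux hW1 L 1 hW1 g hg
  refine ⟨fun u => w u.1 u.2.1 u.2.2, ?_⟩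
  ext n
  have h := hw (fun _ => (n : ℝ) + 1) 0
  rw [hgx] at h
  change (1 / 2 : ℝ) ≤ squareNet L w _ (Fin.castLE hW1 0) ↔ _
  rw [h]
  by_cases hn : n ∈ blockSet N c
  · simp only [hn, if_true, iff_true]; norm_num
  · simp only [hn, if_false, iff_false]; norm_num

lemma mul_one_add_log_le_of_representable {N M W L : ℕ} (hW : 2 ≤ W) (hL : 1 ≤ L) (hM : 1 ≤ M)
    (hMN : M ≤ N) (hrep : ∀ x : Fin N → ℤ, ∑ n, |x n| ≤ (M : ℤ) →
      ∃ g ∈ NN 1 1 W L, ∀ n : Fin N, g (fun _ => (n : ℝ) + 1) 0 = x n) :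
    (M : ℝ) * (1 + Real.log ((N : ℝ) / M)) ≤
      18 * ((W : ℝ) * L) ^ 2 * (Real.log N + 7 * Real.log ((W : ℝ) * L)) := by
  have hpow := pow_le_of_representable hW hrep
  have hM0 : (0 : ℝ) < M := by exact_mod_cast hM
  have hN1 : (1 : ℝ) ≤ N := by exact_mod_cast hM.trans hMN
  have hW2 : (2 : ℝ) ≤ W := by exact_mod_cast hW
  have hL1 : (1 : ℝ) ≤ L := by exact_mod_cast hL
  set S : ℝ := (W : ℝ) * L with hS
  have hS2 : 2 ≤ S := by nlinarith
  have hWS : (W : ℝ) ≤ S := by nlinarith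
  have hlog2 : (1 : ℝ) / 2 < Real.log 2 := by linarith [Real.log_two_gt_d9]
  have hq1 : 1 ≤ N / M := (Nat.one_le_div_iff hM).mpr hMN
  have hq : (N : ℝ) / M ≤ ((N / M + 1 : ℕ) : ℝ) := by
    rw [div_le_iff₀ hM0]
    exact_mod_cast (Nat.lt_mul_of_div_lt (Nat.lt_succ_self (N / M)) hM).le
  have hleft : (M : ℝ) * (1 + Real.log ((N : ℝ) / M)) ≤
      3 * (M * Real.log ((N / M + 1 : ℕ) : ℝ)) := by
    have h1 : Real.log 2 ≤ Real.log ((N / M + 1 : ℕ) : ℝ) :=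
      Real.log_le_log two_pos (by exact_mod_cast Nat.succ_le_succ hq1)
    have h2 : Real.log ((N : ℝ) / M) ≤ Real.log ((N / M + 1 : ℕ) : ℝ) :=
      Real.log_le_log (by positivity) hq
    nlinarith
  have hright : M * Real.log ((N / M + 1 : ℕ) : ℝ) ≤
      6 * S ^ 2 * (Real.log N + 7 * Real.log S) := by
    have h1 : ((N / M + 1 : ℕ) : ℝ) ^ M ≤
        (((((L : ℝ) + 1) * (W * (W + 1)) + 1) * (N * W * (L + 1) + 1)) ^
          ((L + 1) * (W * (W + 1)))) ^ (L + 1) := by exact_mod_cast hpow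
    have h2 := Real.log_le_log (by positivity) h1
    rw [Real.log_pow, Real.log_pow, Real.log_pow] at h2
    refine h2.trans ?_
    have hP : ((L : ℝ) + 1) * (W * (W + 1)) ≤ 3 * (W * S) := by
      have : ((L : ℝ) + 1) * (W + 1) ≤ (2 * L) * (3 / 2 * W) := by gcongr <;> linarith
      nlinarith
    have hP4 : ((L : ℝ) + 1) * (W * (W + 1)) + 1 ≤ S ^ 4 := by
      have h5 : (W : ℝ) * S ≤ S ^ 2 := by nlinarith
      nlinarith
    have hm : (N : ℝ) * W * (L + 1) + 1 ≤ N * S ^ 3 := by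
      have h5 : (W : ℝ) * (L + 1) ≤ 2 * S := by nlinarith
      have h6 : 3 * S ≤ S ^ 3 := by nlinarith [sq_nonneg S]
      nlinarith
    have h3 : Real.log ((((L : ℝ) + 1) * (W * (W + 1)) + 1) * (N * W * (L + 1) + 1)) ≤
        Real.log N + 7 * Real.log S := by
      have h5 : (((L : ℝ) + 1) * (W * (W + 1)) + 1) * (N * W * (L + 1) + 1) ≤ N * S ^ 7 := by
        calc _ ≤ S ^ 4 * (N * S ^ 3) := by gcongr
          _ = _ := by ring
      have h6 := Real.log_le_log (by positivity) h5
      rw [Real.log_mul (x := (N : ℝ)) (by positivity) (by positivity), Real.log_pow] at h6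
      exact_mod_cast h6
    push_cast
    rw [← mul_assoc]
    refine mul_le_mul ?_ h3 (Real.log_nonneg ?_) (by positivity)
    · calc ((L : ℝ) + 1) * ((L + 1) * (W * (W + 1))) ≤ (2 * L) * (3 * (W * S)) := by
            gcongr; linarith
        _ = 6 * S ^ 2 := by rw [hS]; ring
    · have h5 : 0 ≤ ((L : ℝ) + 1) * (W * (W + 1)) := by positivity
      have h6 : 0 ≤ (N : ℝ) * W * (L + 1) := by positivity
      nlinarith
  linarith

theorem rep_lower_bound_sparse (p C₀ : ℝ) (hp : 1 ≤ p) (hC₀ : 0 < C₀) :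
    ∃ c : ℝ, 0 < c ∧
      ∀ N M W L : ℕ, 2 ≤ W → 1 ≤ L → M ≤ N → C₀ * (N : ℝ) ^ p⁻¹ ≤ (M : ℝ) →
        (∀ x : Fin N → ℤ, ∑ n, |x n| ≤ (M : ℤ) →
          ∃ g ∈ NN 1 1 W L, ∀ n : Fin N, g (fun _ => (n : ℝ) + 1) 0 = x n) →
        c * M * (1 + Real.log ((N : ℝ) / M)) ≤
          (W : ℝ) ^ 2 * (L : ℝ) ^ 2 * Real.log ((W : ℝ) * L) := by
  have hp0 : 0 < p := by linarith
  have hlog2 : 0 < Real.log 2 := Real.log_pos one_lt_two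
  set B : ℝ := 18 * (2 * p + 7) / C₀ with hB
  have hB0 : 0 < B := by positivity
  set C : ℝ := 2 * p * (|Real.log B| / Real.log 2 + 3) with hC
  have hC0 : 0 ≤ C := by positivity
  refine ⟨1 / (18 * (C + 7)), by positivity, fun N M W L hW hL hMN hNM hrep => ?_⟩
  have hW2 : (2 : ℝ) ≤ W := by exact_mod_cast hW
  have hL1 : (1 : ℝ) ≤ L := by exact_mod_cast hL
  rw [← mul_pow]
  set S : ℝ := (W : ℝ) * L with hS
  have hS2 : 2 ≤ S := by nlinarith
  have hlogS : Real.log 2 ≤ Real.log S := Real.log_le_log two_pos hS2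
  rcases Nat.eq_zero_or_pos M with rfl | hM
  · simp only [Nat.cast_zero, mul_zero, zero_mul]
    exact mul_nonneg (sq_nonneg S) (hlog2.le.trans hlogS)
  have hmain := mul_one_add_log_le_of_representable hW hL hM hMN hrep
  have hM0 : (0 : ℝ) < M := by exact_mod_cast hM
  have hN1 : (1 : ℝ) ≤ N := by exact_mod_cast hM.trans_le hMN
  have hN0 : (0 : ℝ) < N := by linarith
  set y : ℝ := (N : ℝ) ^ (2 * p)⁻¹ with hy
  have hy1 : 1 ≤ y := Real.one_le_rpow hN1 (by positivity)
  have hyy : (N : ℝ) ^ p⁻¹ = y * y := by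
    rw [hy, ← Real.rpow_add hN0]
    congr 1
    field_simp
    norm_num
  have hlogy : Real.log N = 2 * p * Real.log y := by
    rw [hy, Real.log_rpow hN0]
    field_simp
  have hyS : y ≤ B * S ^ 3 := by
    have h1 : (M : ℝ) ≤ M * (1 + Real.log ((N : ℝ) / M)) := by
      refine le_mul_of_one_le_right hM0.le ?_
      have : 0 ≤ Real.log ((N : ℝ) / M) :=
        Real.log_nonneg ((one_le_div hM0).mpr (by exact_mod_cast hMN))
      linarith
    have h2 : Real.log y ≤ y := Real.log_le_self (by linarith)
    have h3 : Real.log S ≤ S := Real.log_le_self (by linarith)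
    have h4 : Real.log N + 7 * Real.log S ≤ (2 * p + 7) * (S * y) := by
      have h5 : y ≤ S * y := by nlinarith
      have h6 : S ≤ S * y := by nlinarith
      rw [hlogy]
      nlinarith
    have h7 : C₀ * (y * y) ≤ 18 * S ^ 2 * ((2 * p + 7) * (S * y)) := by
      rw [← hyy]
      refine hNM.trans (h1.trans (hmain.trans ?_))
      gcongr
    have h8 : (C₀ * y) * y ≤ (18 * (2 * p + 7) * S ^ 3) * y := by linarith
    have h9 := le_of_mul_le_mul_right h8 (by linarith)
    rw [hB, div_mul_eq_mul_div, le_div_iff₀ hC₀]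
    linarith
  have hlogN : Real.log N ≤ C * Real.log S := by
    have h1 := Real.log_le_log (by linarith) hyS
    rw [Real.log_mul hB0.ne' (by positivity), Real.log_pow] at h1
    have h2 : Real.log B ≤ |Real.log B| / Real.log 2 * Real.log S := by
      refine (le_abs_self _).trans ?_
      rw [div_mul_eq_mul_div, le_div_iff₀ hlog2]
      gcongr
    rw [hlogy, hC, mul_assoc (2 * p)]
    refine mul_le_mul_of_nonneg_left ?_ (by positivity)
    push_cast at h1
    linarith
  rw [mul_assoc, one_div, inv_mul_le_iff₀ (by positivity)]
  refine hmain.trans ?_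
  calc _ ≤ 18 * S ^ 2 * (C * Real.log S + 7 * Real.log S) := by gcongr
    _ = _ := by ring
end
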